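/- arXiv:2111.03298 — 4 statements merged into one kernel-verified Lean document; each statement's English description precedes it below -/
import Mathlib

section
/- If G is a non-trivial quasi-tree (a connected graph that is not a tree but contains a vertex x such that G − x is a tree), then γ_t(G) ≤ a(G) + 1. -/
open SimpleGraph

/-- The total domination number of a graph: the minimum cardinality of a set `D`
such that every vertex has a neighbor in `D`. -/
noncomputable def totalDominationNumber {V : Type*} (G : SimpleGraph V) : ℕ :=
  sInf {k | ∃ D : Finset V, (∀ v : V, ∃ u ∈ D, G.Adj v u) ∧ D.card = k}

/-- The annihilation number of a graph: the largest `k` such that there exist `k`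
distinct vertices whose degree sum is at most the number of edges. -/
noncomputable def annihilationNumber {V : Type*} (G : SimpleGraph V) : ℕ :=
  sSup {k | ∃ S : Finset V, S.card = k ∧ ∑ v ∈ S, (G.neighborSet v).ncard ≤ G.edgeSet.ncard}

section helpers
open Classical in
lemma qt_tdn_le {V : Type*} (G : SimpleGraph V) (D : Finset V)
    (h : ∀ v : V, ∃ u ∈ D, G.Adj v u) : totalDominationNumber G ≤ D.card :=
  Nat.sInf_le ⟨D, h, rfl⟩

lemma qt_le_ann {V : Type*} [Fintype V] (G : SimpleGraph V) (S : Finset V)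
    (h : ∑ v ∈ S, (G.neighborSet v).ncard ≤ G.edgeSet.ncard) :
    S.card ≤ annihilationNumber G := by
  refine le_csSup ⟨Fintype.card V, ?_⟩ ⟨S, rfl, h⟩
  rintro k ⟨S, rfl, -⟩
  exact Finset.card_le_univ S

/-- Parent in a rooted tree. -/
lemma qt_parent {W : Type*} (T : SimpleGraph W) (hT : T.IsTree) (p v : W) (hv : v ≠ p) :
    ∃ u, T.Adj v u ∧ T.dist p v = T.dist p u + 1 := by
  obtain ⟨w, hw⟩ := hT.connected.exists_walk_length_eq_dist v p
  cases w with
  | nil => exact absurd rfl hv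
  | cons h q =>
    rename_i u
    refine ⟨u, h, ?_⟩
    have h1 : T.dist u p ≤ q.length := SimpleGraph.dist_le q
    rw [SimpleGraph.Walk.length_cons] at hw
    rw [SimpleGraph.dist_comm (u := p) (v := v), SimpleGraph.dist_comm (u := p) (v := u)]
    have h2 := hT.dist_eq_dist_add_one_of_adj p h
    rw [SimpleGraph.dist_comm (u := p) (v := v), SimpleGraph.dist_comm (u := p) (v := u)] at h2
    omega

lemma qt_parent_unique {W : Type*} (T : SimpleGraph W) (hT : T.IsTree) (p v u₁ u₂ : W)
    (h₁ : T.Adj v u₁) (h₂ : T.Adj v u₂) (d₁ : T.dist p v = T.dist p u₁ + 1)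
    (d₂ : T.dist p v = T.dist p u₂ + 1) : u₁ = u₂ := by
  obtain ⟨w₁, hw₁⟩ := hT.connected.exists_walk_length_eq_dist p u₁
  obtain ⟨w₂, hw₂⟩ := hT.connected.exists_walk_length_eq_dist p u₂
  have e₁ := (w₁.concat h₁.symm).isPath_of_length_eq_dist (by simp [hw₁, d₁])
  have e₂ := (w₂.concat h₂.symm).isPath_of_length_eq_dist (by simp [hw₂, d₂])
  have e := (hT.existsUnique_path p v).unique e₁ e₂
  have := congrArg SimpleGraph.Walk.penultimate e
  simpa using this

lemma qt_child {W : Type*} [Fintype W] (T : SimpleGraph W) [DecidableRel T.Adj]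
    (hT : T.IsTree) (p v : W)
    (hd : 2 ≤ T.degree v ∨ (v = p ∧ 1 ≤ T.degree v)) :
    ∃ u, T.Adj v u ∧ T.dist p u = T.dist p v + 1 := by
  rcases hd with hd | ⟨rfl, hd⟩
  · obtain ⟨a, ha, b, hb, hab⟩ := Finset.one_lt_card.1 (show 1 < (T.neighborFinset v).card from hd)
    rw [SimpleGraph.mem_neighborFinset] at ha hb
    rcases hT.dist_eq_dist_add_one_of_adj p ha with h1 | h1
    · rcases hT.dist_eq_dist_add_one_of_adj p hb with h2 | h2
      · exact absurd (qt_parent_unique T hT p v a b ha hb h1 h2) hab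
      · exact ⟨b, hb, h2⟩
    · exact ⟨a, ha, h1⟩
  · obtain ⟨a, ha⟩ := Finset.card_pos.1 (show 0 < (T.neighborFinset v).card from hd)
    rw [SimpleGraph.mem_neighborFinset] at ha
    refine ⟨a, ha, ?_⟩
    rw [SimpleGraph.dist_self, SimpleGraph.dist_eq_one_iff_adj.2 ha]

open Classical in
/-- Level argument: choosing two consecutive level classes modulo four. -/
lemma qt_levels {V : Type*} [Fintype V] (G : SimpleGraph V) (x c : V) (lev : V → ℕ) (par : V → V)
    (K : Finset V) (hx0 : lev x = 0) (hc : G.Adj x c)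
    (hpar : ∀ v, v ≠ x → G.Adj v (par v) ∧ lev v = lev (par v) + 1)
    (hK : ∀ v, v ∉ K → ∃ u, G.Adj v u ∧ lev u = lev v + 1) (hxK : x ∉ K) :
    2 * totalDominationNumber G ≤ Fintype.card V + K.card + 1 := by
  let A : ℕ → Finset V := fun i => Finset.univ.filter (fun v => lev v % 4 = i)
  let B : ℕ → Finset V := fun i => K.filter (fun v => lev v % 4 = i)
  have hA : ∀ s : Finset V, (s.filter (fun v => lev v % 4 = 0)).card
      + (s.filter (fun v => lev v % 4 = 1)).card
      + (s.filter (fun v => lev v % 4 = 2)).card + (s.filter (fun v => lev v % 4 = 3)).card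
      = s.card := by
    intro s
    simp only [Finset.card_filter, ← Finset.sum_add_distrib]
    rw [Finset.card_eq_sum_ones]
    refine Finset.sum_congr rfl fun v _ => ?_
    have : lev v % 4 < 4 := Nat.mod_lt _ (by norm_num)
    split_ifs <;> omega
  have key : ∀ i j k l : ℕ, ∀ E : Finset V, j = (i+1) % 4 → k = (i+2)%4 → l = (i+3) % 4 → i < 4 →
      ((i = 2 ∨ i = 3) → c ∈ E) →
      totalDominationNumber G ≤ (A i).card + (A j).card + (B i).card + (B l).card + E.card := by
    intro i j k l E hj hk hl hi hE
    refine (qt_tdn_le G (A i ∪ A j ∪ (B i).image par ∪ (B l).image par ∪ E) ?_).trans ?_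
    · intro v
      by_cases hvx : v = x ∧ (i = 2 ∨ i = 3)
      · exact ⟨c, by simp [hE hvx.2], hvx.1 ▸ hc⟩
      by_cases hm : lev v % 4 = j ∨ lev v % 4 = k
      · have hne : v ≠ x := by
          rintro rfl
          rw [hx0] at hm
          apply hvx; refine ⟨rfl, ?_⟩
          omega
        obtain ⟨h1, h2⟩ := hpar v hne
        refine ⟨par v, ?_, h1⟩
        simp only [Finset.mem_union, A, Finset.mem_filter, Finset.mem_univ, true_and]
        have : lev (par v) % 4 = i ∨ lev (par v) % 4 = j := by omega
        tauto
      · have hm' : lev v % 4 = i ∨ lev v % 4 = l := by omega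
        by_cases hvK : v ∈ K
        · obtain ⟨h1, h2⟩ := hpar v (by rintro rfl; exact hxK hvK)
          refine ⟨par v, ?_, h1⟩
          simp only [Finset.mem_union]
          rcases hm' with h | h
          · have : par v ∈ (B i).image par := Finset.mem_image_of_mem _ (by simp [B, hvK, h])
            tauto
          · have : par v ∈ (B l).image par := Finset.mem_image_of_mem _ (by simp [B, hvK, h])
            tauto
        · obtain ⟨u, h1, h2⟩ := hK v hvK
          refine ⟨u, ?_, h1⟩
          simp only [Finset.mem_union, A, Finset.mem_filter, Finset.mem_univ, true_and]
          have : lev u % 4 = i ∨ lev u % 4 = j := by omega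
          tauto
    · have e1 := Finset.card_union_le (A i ∪ A j ∪ (B i).image par ∪ (B l).image par) E
      have e2 := Finset.card_union_le (A i ∪ A j ∪ (B i).image par) ((B l).image par)
      have e3 := Finset.card_union_le (A i ∪ A j) ((B i).image par)
      have e4 := Finset.card_union_le (A i) (A j)
      have e5 : ((B i).image par).card ≤ (B i).card := Finset.card_image_le
      have e6 : ((B l).image par).card ≤ (B l).card := Finset.card_image_le
      omega
  have k0 := key 0 1 2 3 ∅ rfl rfl rfl (by norm_num) (by simp)
  have k1 := key 1 2 3 0 ∅ rfl rfl rfl (by norm_num) (by simp)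
  have k2 := key 2 3 0 1 {c} rfl rfl rfl (by norm_num) (by simp)
  have k3 := key 3 0 1 2 {c} rfl rfl rfl (by norm_num) (by simp)
  have a1 : (A 0).card + (A 1).card + (A 2).card + (A 3).card = Fintype.card V := hA Finset.univ
  have a2 : (B 0).card + (B 1).card + (B 2).card + (B 3).card = K.card := hA K
  simp only [Finset.card_empty, Finset.card_singleton] at k0 k1 k2 k3
  omega

open Classical in
lemma qt_nonleaf {V : Type*} [Fintype V] (G : SimpleGraph V) (x c : V) (par : V → V)
    (K : Finset V) (hc : G.Adj x c)
    (hpar : ∀ v, v ≠ x → G.Adj v (par v) ∧ par v ∉ K) :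
    totalDominationNumber G + K.card ≤ Fintype.card V + (if c ∈ K then 1 else 0) := by
  have h := qt_tdn_le G (Kᶜ ∪ {c}) (by
    intro v
    by_cases hv : v = x
    · exact ⟨c, by simp, hv ▸ hc⟩
    · exact ⟨par v, by simp [(hpar v hv).2], (hpar v hv).1⟩)
  have h2 : Kᶜ.card + K.card = Fintype.card V := by
    rw [add_comm]; exact Finset.card_add_card_compl K
  split_ifs with hcK
  · have := Finset.card_union_le Kᶜ {c}
    simp only [Finset.card_singleton] at this
    omega
  · have : Kᶜ ∪ {c} = Kᶜ := by
      ext v; simp; rintro rfl; exact hcK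
    rw [this] at h
    omega

open Classical in
lemma qt_bounds {V : Type*} [Fintype V] (G : SimpleGraph V) (x : V)
    (T : SimpleGraph {u : V // u ≠ x}) (hT : T.IsTree)
    (hTG : ∀ a b, T.Adj a b ↔ G.Adj a.1 b.1) (p : {u : V // u ≠ x}) (hp : G.Adj x p.1)
    (hdeg : ∀ v, 1 ≤ T.degree v) (L : Finset {u : V // u ≠ x})
    (hL : ∀ v, v ∈ L ↔ T.degree v = 1) :
    2 * totalDominationNumber G ≤ Fintype.card V + (L.erase p).card + 1 ∧
    totalDominationNumber G + (L.erase p).card ≤ Fintype.card V := by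
  have hparT : ∀ v : {u : V // u ≠ x}, ∃ u, v ≠ p → T.Adj v u ∧ T.dist p v = T.dist p u + 1 := by
    intro v
    by_cases hv : v = p
    · exact ⟨p, fun h => absurd hv h⟩
    · obtain ⟨u, hu⟩ := qt_parent T hT p v hv
      exact ⟨u, fun _ => hu⟩
  choose pT hpT using hparT
  let lev : V → ℕ := fun v => if h : v = x then 0 else T.dist p ⟨v, h⟩ + 1
  let par : V → V := fun v => if h : v = x then x else
    if (⟨v, h⟩ : {u : V // u ≠ x}) = p then x else (pT ⟨v, h⟩).1
  let K : Finset V := (L.erase p).map (Function.Embedding.subtype _)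
  have hKc : K.card = (L.erase p).card := Finset.card_map _
  have levx : lev x = 0 := by simp [lev]
  have levW : ∀ v : {u : V // u ≠ x}, lev v.1 = T.dist p v + 1 := by
    intro v; simp [lev, v.2]
  have parp : par p.1 = x := by simp [par]
  have parW : ∀ v : {u : V // u ≠ x}, v ≠ p → par v.1 = (pT v).1 := by
    intro v hv; simp [par, v.2, hv]
  have hKx : x ∉ K := by simp [K]
  have hKW : ∀ v : {u : V // u ≠ x}, v.1 ∈ K ↔ v ≠ p ∧ T.degree v = 1 := by
    intro v
    have : v.1 ∈ K ↔ v ∈ L.erase p :=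
      Finset.mem_map' (Function.Embedding.subtype (fun u : V => u ≠ x)) (a := v)
    rw [this, Finset.mem_erase, hL]
  have hpar : ∀ v, v ≠ x → G.Adj v (par v) ∧ lev v = lev (par v) + 1 := by
    intro v hv
    lift v to {u : V // u ≠ x} using hv
    by_cases h : v = p
    · subst h
      rw [parp, levx, levW, SimpleGraph.dist_self]
      exact ⟨hp.symm, rfl⟩
    · obtain ⟨h1, h2⟩ := hpT v h
      rw [parW v h, levW, levW, h2]
      exact ⟨(hTG _ _).1 h1, rfl⟩
  have hch : ∀ v, v ∉ K → ∃ u, G.Adj v u ∧ lev u = lev v + 1 := by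
    intro v hv
    by_cases hvx : v = x
    · refine ⟨p.1, hvx ▸ hp, ?_⟩
      rw [hvx, levx, levW, SimpleGraph.dist_self]
    · lift v to {u : V // u ≠ x} using hvx
      rw [hKW] at hv
      obtain ⟨u, h1, h2⟩ := qt_child T hT p v (by
        have := hdeg v
        by_cases h : v = p
        · right; exact ⟨h, this⟩
        · left
          have : T.degree v ≠ 1 := fun h' => hv ⟨h, h'⟩
          omega)
      exact ⟨u.1, (hTG _ _).1 h1, by rw [levW, levW, h2]⟩
  have hpK : p.1 ∉ K := by rw [hKW]; simp
  have hparK : ∀ v, v ≠ x → par v ∉ K := by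
    intro v hv
    lift v to {u : V // u ≠ x} using hv
    by_cases h : v = p
    · subst h; rw [parp]; exact hKx
    · obtain ⟨h1, h2⟩ := hpT v h
      rw [parW v h, hKW]
      rintro ⟨h3, h4⟩
      obtain ⟨h5, h6⟩ := hpT _ h3
      have h7 : 1 < (T.neighborFinset (pT v)).card := by
        refine Finset.one_lt_card.2 ⟨v, by simpa using h1.symm, pT (pT v), by simpa using h5, ?_⟩
        intro h8
        rw [← h8] at h6
        omega
      rw [SimpleGraph.card_neighborFinset_eq_degree] at h7
      omega
  rw [← hKc]
  refine ⟨qt_levels G x p.1 lev par K levx hp hpar hch hKx, ?_⟩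
  have := qt_nonleaf G x p.1 par K hp (fun v hv => ⟨(hpar v hv).1, hparK v hv⟩)
  rwa [if_neg hpK] at this

open Classical in
lemma qt_main {V : Type*} [Fintype V] (G : SimpleGraph V) (x : V)
    (T : SimpleGraph {u : V // u ≠ x}) (hT : T.IsTree)
    (hTG : ∀ a b, T.Adj a b ↔ G.Adj a.1 b.1) (p : {u : V // u ≠ x}) (hp : G.Adj x p.1)
    (hN : Nontrivial {u : V // u ≠ x}) :
    totalDominationNumber G ≤ annihilationNumber G + 1 := by
  have hdeg : ∀ v, 1 ≤ T.degree v := fun v =>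
    hT.connected.preconnected.degree_pos_of_nontrivial v
  let L : Finset {u : V // u ≠ x} := Finset.univ.filter (fun v => T.degree v = 1)
  let A : Finset {u : V // u ≠ x} := Finset.univ.filter (fun v => T.degree v = 2)
  let B : Finset {u : V // u ≠ x} := Finset.univ.filter (fun v => 3 ≤ T.degree v)
  let X : Finset {u : V // u ≠ x} := Finset.univ.filter (fun v => G.Adj x v.1)
  obtain ⟨b1, b2⟩ := qt_bounds G x T hT hTG p hp hdeg L (by simp [L])
  have hcardV : Fintype.card V = Fintype.card {u : V // u ≠ x} + 1 := by
    have := Fintype.card_subtype_compl (fun u : V => u = x)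
    have h1 : Fintype.card {u : V // u = x} = 1 := Fintype.card_subtype_eq x
    have h2 : 0 < Fintype.card V := Fintype.card_pos_iff.2 ⟨x⟩
    rw [h1] at this
    simp only [ne_eq]
    omega
  have hE := hT.card_edgeFinset
  have hsumT := T.sum_degrees_eq_twice_card_edges
  have hcard : L.card + A.card + B.card = Fintype.card {u : V // u ≠ x} := by
    simp only [L, A, B, Finset.card_filter, ← Finset.sum_add_distrib]
    rw [← Finset.card_univ, Finset.card_eq_sum_ones]
    refine Finset.sum_congr rfl fun v _ => ?_
    have := hdeg v
    split_ifs <;> omega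
  have hBsum : L.card + 2 * A.card + 3 * B.card ≤ ∑ v, T.degree v := by
    simp only [L, A, B, Finset.card_filter, Finset.mul_sum, ← Finset.sum_add_distrib]
    refine Finset.sum_le_sum fun v _ => ?_
    have := hdeg v
    split_ifs <;> omega
  -- degrees in `G`
  have hdegG : ∀ v : {u : V // u ≠ x}, G.degree v.1 = T.degree v + (if v ∈ X then 1 else 0) := by
    intro v
    have h1 : G.neighborFinset v.1 = (T.neighborFinset v).map (Function.Embedding.subtype _) ∪
        (if v ∈ X then {x} else ∅) := by
      ext u
      by_cases hu : u = x
      · subst hu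
        by_cases hv : G.Adj u v.1
        · simp [X, hv, hv.symm]
        · have : ¬ G.Adj v.1 u := fun h => hv h.symm
          simp [X, hv, this]
      · have : u ∉ (if v ∈ X then ({x} : Finset V) else ∅) := by
          split_ifs <;> simp [hu]
        simp [this, hu, hTG]
    rw [← SimpleGraph.card_neighborFinset_eq_degree, h1, Finset.card_union_of_disjoint,
      Finset.card_map, SimpleGraph.card_neighborFinset_eq_degree]
    · congr 1
      split_ifs <;> simp
    · split_ifs <;> simp
  have hsumS : ∀ S : Finset {u : V // u ≠ x},
      ∑ v ∈ S, G.degree v.1 = ∑ v ∈ S, T.degree v + (S ∩ X).card := by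
    intro S
    rw [Finset.sum_congr rfl (fun v _ => hdegG v), Finset.sum_add_distrib]
    congr 1
    simp
  have hdegx : G.degree x = X.card := by
    rw [← SimpleGraph.card_neighborFinset_eq_degree]
    have : G.neighborFinset x = X.map (Function.Embedding.subtype _) := by
      ext u
      simp only [SimpleGraph.mem_neighborFinset, Finset.mem_map, X, Finset.mem_filter,
        Finset.mem_univ, true_and, Function.Embedding.subtype_apply, Subtype.exists]
      constructor
      · intro h; exact ⟨u, h.ne', h, rfl⟩
      · rintro ⟨a, ha, h, rfl⟩; exact h
    rw [this, Finset.card_map]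
  have hsumG := G.sum_degrees_eq_twice_card_edges
  have hsplit : ∑ v, G.degree v = G.degree x + ∑ v : {u : V // u ≠ x}, G.degree v.1 := by
    rw [Fintype.sum_eq_add_sum_subtype_ne _ x]
  rw [hsplit, hdegx, hsumS, Finset.univ_inter] at hsumG
  have hm : G.edgeFinset.card + 1 = Fintype.card {u : V // u ≠ x} + X.card := by omega
  have hann : ∀ S : Finset {u : V // u ≠ x},
      ∑ v ∈ S, T.degree v + (S ∩ X).card ≤ G.edgeFinset.card → S.card ≤ annihilationNumber G := by
    intro S hS
    have := qt_le_ann G (S.map (Function.Embedding.subtype _)) (by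
      rw [Finset.sum_map, Set.ncard_eq_toFinset_card' G.edgeSet]
      refine le_trans (le_of_eq ?_) hS
      rw [← hsumS]
      refine Finset.sum_congr rfl fun v _ => ?_
      rw [Set.ncard_eq_toFinset_card']
      rfl)
    rwa [Finset.card_map] at this
  have hLA : ∀ A' ⊆ A, (L ∪ A').card = L.card + A'.card ∧
      ∑ v ∈ L ∪ A', T.degree v = L.card + 2 * A'.card := by
    intro A' hA'
    have hdis : Disjoint L A' := by
      rw [Finset.disjoint_left]
      intro v hv hv'
      have h1 := hA' hv'
      simp only [L, A, Finset.mem_filter] at hv h1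
      omega
    refine ⟨Finset.card_union_of_disjoint hdis, ?_⟩
    rw [Finset.sum_union hdis, Finset.sum_congr rfl (g := fun _ => 1),
      Finset.sum_congr (s₁ := A') rfl (g := fun _ => 2)]
    · simp [mul_comm]
    · intro v hv
      have h1 := hA' hv
      simpa [A] using h1
    · intro v hv
      simpa [L] using hv
  have hX : ∀ S : Finset {u : V // u ≠ x}, (S ∩ X).card ≤ X.card := fun S =>
    Finset.card_le_card Finset.inter_subset_right
  have hpX : p ∈ X := by simp [X, hp]
  -- sets of leaves and `j` vertices of degree two
  have hj : ∀ j, j ≤ A.card → L.card + 2 * j + 1 ≤ Fintype.card {u : V // u ≠ x} →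
      L.card + j ≤ annihilationNumber G := by
    intro j hj1 hj2
    obtain ⟨A', hA', hc⟩ := Finset.exists_subset_card_eq hj1
    obtain ⟨h1, h2⟩ := hLA A' hA'
    have h3 := hX (L ∪ A')
    have := hann (L ∪ A') (by omega)
    omega
  have hj' : p ∉ L → ∀ j, j + 1 ≤ A.card → L.card + 2 * j ≤ Fintype.card {u : V // u ≠ x} →
      L.card + j ≤ annihilationNumber G := by
    intro hpL j hj1 hj2
    have h0 : j ≤ (A.erase p).card := by
      have := Finset.pred_card_le_card_erase (s := A) (a := p)
      omega
    obtain ⟨A', hA', hc⟩ := Finset.exists_subset_card_eq h0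
    obtain ⟨h1, h2⟩ := hLA A' (hA'.trans (Finset.erase_subset _ _))
    have h3 : ((L ∪ A') ∩ X).card < X.card := by
      refine Finset.card_lt_card ⟨Finset.inter_subset_right, fun h => ?_⟩
      have h4 := Finset.mem_inter.1 (h hpX)
      rcases Finset.mem_union.1 h4.1 with h5 | h5
      · exact hpL h5
      · exact (Finset.mem_erase.1 (hA' h5)).1 rfl
    have := hann (L ∪ A') (by omega)
    omega
  have hNL : B.card + 2 ≤ L.card := by omega
  by_cases hAB : A.card < B.card
  · have h1 := hj A.card le_rfl (by omega)
    have h2 := Finset.pred_card_le_card_erase (s := L) (a := p)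
    omega
  · by_cases hpL : p ∈ L
    · have h2 := Finset.card_erase_of_mem hpL
      have h1 := hj ((A.card + B.card - 1) / 2) (by omega)
      by_cases h0 : A.card + B.card = 0
      · have h5 : ∑ v ∈ L.erase p, T.degree v = (L.erase p).card := by
          rw [Finset.card_eq_sum_ones]
          refine Finset.sum_congr rfl fun v hv => ?_
          simpa [L] using (Finset.mem_erase.1 hv).2
        have h6 := hX (L.erase p)
        have := hann (L.erase p) (by omega)
        omega
      · have := h1 (by omega)
        omega
    · have h2 : L.erase p = L := Finset.erase_eq_of_notMem hpL
      rw [h2] at b1 b2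
      have h3 : 0 < A.card + B.card := by
        have : p ∈ A ∨ p ∈ B := by
          have := hdeg p
          simp only [A, B, L, Finset.mem_filter, Finset.mem_univ, true_and] at hpL ⊢
          omega
        rcases this with h | h
        · have := Finset.card_pos.2 ⟨p, h⟩; omega
        · have := Finset.card_pos.2 ⟨p, h⟩; omega
      by_cases hpar : (A.card + B.card) % 2 = 1
      · have h1 := hj ((A.card + B.card - 1) / 2) (by omega) (by omega)
        omega
      · by_cases hAB' : A.card = B.card
        · have h1 := hj (A.card - 1) (by omega) (by omega)
          omega
        · have h1 := hj' hpL ((A.card + B.card) / 2) (by omega) (by omega)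
          omega
end helpers

/-- If `G` is a non-trivial quasi-tree (a connected graph that is not a tree but
contains a vertex `x` such that `G − x` is a tree), then `γₜ(G) ≤ a(G) + 1`. -/
theorem stmt_0 {V : Type*} [Fintype V] (G : SimpleGraph V)
    (hconn : G.Connected) (hnt : ¬ G.IsTree)
    (hqt : ∃ x : V, ((G.induce {u | u ≠ x}).IsTree)) :
    totalDominationNumber G ≤ annihilationNumber G + 1 := by
  classical
  obtain ⟨x, hT⟩ := hqt
  obtain ⟨w⟩ := hT.connected.nonempty
  have hVn : Nontrivial V := ⟨w.1, x, w.2⟩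
  have hdx := hconn.preconnected.degree_pos_of_nontrivial x
  obtain ⟨p, hp⟩ := (G.degree_pos_iff_exists_adj x).1 hdx
  refine qt_main G x (G.induce {u | u ≠ x}) hT (fun a b => Iff.rfl) ⟨p, hp.ne'⟩ hp ?_
  by_contra hN
  rw [not_nontrivial_iff_subsingleton] at hN
  refine hnt ⟨hconn, SimpleGraph.IsAcyclic.of_card_le_two ?_⟩
  have h1 : Fintype.card {u : V // u ≠ x} ≤ 1 := Fintype.card_le_one_iff_subsingleton.2 hN
  have := Fintype.card_subtype_compl (fun u : V => u = x)
  have h2 : Fintype.card {u : V // u = x} = 1 := Fintype.card_subtype_eq x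
  simp only [ne_eq] at h1
  rw [ENat.card_eq_coe_fintype_card]
  have : Fintype.card V ≤ 2 := by omega
  exact_mod_cast this
end

section
/- Let G ∈ QT_5 and let G' = G[V(G) \ {x, w, v, z}] be the subgraph of G induced by all vertices except x, w, v, z. If γ_t(G') ≤ a(G') + 1, then γ_t(G) ≤ a(G) + 1. -/
open SimpleGraph

/-- Statuses used in the definition of the family `Γ`. -/
inductive Status
  | A | B | C

/-- A graph whose vertices are labeled with statuses. -/
structure LGraph where
  V : Type
  G : SimpleGraph V
  sta : V → Status

/-- Status-preserving isomorphism of labeled graphs. -/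
def LIso (L₁ L₂ : LGraph) : Prop :=
  ∃ e : L₁.G ≃g L₂.G, ∀ v, L₂.sta (e v) = L₁.sta v

/-- The base labeled tree `T₀`: a path `P₆` whose two leaves have status `C`,
whose two support vertices have status `A`, and whose middle vertices have status `B`. -/
def baseT0 : LGraph where
  V := Fin 6
  G := SimpleGraph.fromRel (fun i j => (i : ℕ) + 1 = (j : ℕ))
  sta := ![Status.C, Status.A, Status.B, Status.B, Status.A, Status.C]

/-- Operation `o₁`: to a labeled graph `L` with chosen vertex `y`, attach a new path
`x–w–v–z` (the vertices `Sum.inr 0, 1, 2, 3`) together with the edge `x y`, statuses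
`sta x = sta w = B`, `sta v = A`, `sta z = C`. -/
def o1Ext (L : LGraph) (y : L.V) : LGraph where
  V := L.V ⊕ Fin 4
  G := (L.G.map Function.Embedding.inl) ⊔
    SimpleGraph.fromEdgeSet
      {s(Sum.inl y, Sum.inr 0), s(Sum.inr 0, Sum.inr 1),
       s(Sum.inr 1, Sum.inr 2), s(Sum.inr 2, Sum.inr 3)}
  sta := Sum.elim L.sta ![Status.B, Status.B, Status.A, Status.C]

/-- Operation `o₂`: to a labeled graph `L` with chosen vertex `y`, attach a new path
`x–w–v` (the vertices `Sum.inr 0, 1, 2`) together with the edge `x y`, statuses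
`sta x = B`, `sta w = A`, `sta v = C`. -/
def o2Ext (L : LGraph) (y : L.V) : LGraph where
  V := L.V ⊕ Fin 3
  G := (L.G.map Function.Embedding.inl) ⊔
    SimpleGraph.fromEdgeSet
      {s(Sum.inl y, Sum.inr 0), s(Sum.inr 0, Sum.inr 1), s(Sum.inr 1, Sum.inr 2)}
  sta := Sum.elim L.sta ![Status.B, Status.A, Status.C]

/-- The family `Γ` of labeled trees (closed under status-preserving isomorphism):
it contains `T₀` and is closed under operation `o₁` (applied at a leaf of status `C`)
and operation `o₂` (applied at a vertex of status `B`). -/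
inductive InGamma : LGraph → Prop
  | base (L : LGraph) : LIso baseT0 L → InGamma L
  | op1 (L : LGraph) (y : L.V) (hL : InGamma L) (hsta : L.sta y = Status.C)
      (hleaf : (L.G.neighborSet y).ncard = 1) (L' : LGraph) (h : LIso (o1Ext L y) L') :
      InGamma L'
  | op2 (L : LGraph) (y : L.V) (hL : InGamma L) (hsta : L.sta y = Status.B)
      (L' : LGraph) (h : LIso (o2Ext L y) L') : InGamma L'

/-- Add one new vertex `h = Sum.inr ()` to `G` and join it to every vertex in `S`. -/
def attachVertex {V : Type} (G : SimpleGraph V) (S : Set V) : SimpleGraph (V ⊕ Unit) :=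
  (G.map Function.Embedding.inl) ⊔
    SimpleGraph.fromEdgeSet {e | ∃ u ∈ S, e = s(Sum.inl u, Sum.inr ())}

section Helpers

lemma ncard_sum_aux {α β : Type*} [Finite α] [Finite β] (s : Set (α ⊕ β)) :
    s.ncard = (Sum.inl ⁻¹' s).ncard + (Sum.inr ⁻¹' s).ncard := by
  have h : s = Sum.inl '' (Sum.inl ⁻¹' s) ∪ Sum.inr '' (Sum.inr ⁻¹' s) := by
    ext (a | b) <;> simp
  conv_lhs => rw [h]
  rw [Set.ncard_union_eq, Set.ncard_image_of_injective _ Sum.inl_injective,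
    Set.ncard_image_of_injective _ Sum.inr_injective]
  rw [Set.disjoint_left]
  rintro _ ⟨a, _, rfl⟩ ⟨b, _, hb⟩
  simp at hb

lemma handshake_aux {V : Type*} [Fintype V] (G : SimpleGraph V) :
    ∑ v, (G.neighborSet v).ncard = 2 * G.edgeSet.ncard := by
  classical
  have := G.sum_degrees_eq_twice_card_edges
  rw [← SimpleGraph.coe_edgeFinset, Set.ncard_coe_finset, ← this]
  refine Finset.sum_congr rfl fun v _ => ?_
  rw [Set.ncard_eq_toFinset_card', ← SimpleGraph.card_neighborFinset_eq_degree]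
  rfl

lemma td_le {V : Type*} (G : SimpleGraph V) (D : Finset V)
    (hD : ∀ v, ∃ u ∈ D, G.Adj v u) : totalDominationNumber G ≤ D.card :=
  Nat.sInf_le ⟨D, hD, rfl⟩

lemma td_attained {V : Type*} (G : SimpleGraph V) (D : Finset V)
    (hD : ∀ v, ∃ u ∈ D, G.Adj v u) :
    ∃ D' : Finset V, (∀ v, ∃ u ∈ D', G.Adj v u) ∧ D'.card = totalDominationNumber G :=
  Nat.sInf_mem (s := {k | ∃ D : Finset V, (∀ v : V, ∃ u ∈ D, G.Adj v u) ∧ D.card = k})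
    ⟨_, D, hD, rfl⟩

lemma ann_bdd {V : Type*} [Finite V] (G : SimpleGraph V) :
    BddAbove {k | ∃ S : Finset V, S.card = k ∧
      ∑ v ∈ S, (G.neighborSet v).ncard ≤ G.edgeSet.ncard} := by
  have := Fintype.ofFinite V
  refine ⟨Fintype.card V, ?_⟩
  rintro k ⟨S, rfl, _⟩
  exact Finset.card_le_univ S

lemma le_ann {V : Type*} [Finite V] (G : SimpleGraph V) (S : Finset V)
    (hS : ∑ v ∈ S, (G.neighborSet v).ncard ≤ G.edgeSet.ncard) :
    S.card ≤ annihilationNumber G :=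
  le_csSup (ann_bdd G) ⟨S, rfl, hS⟩

lemma ann_attained {V : Type*} [Finite V] (G : SimpleGraph V) :
    ∃ S : Finset V, S.card = annihilationNumber G ∧
      ∑ v ∈ S, (G.neighborSet v).ncard ≤ G.edgeSet.ncard :=
  Nat.sSup_mem (s := {k | ∃ S : Finset V, S.card = k ∧
      ∑ v ∈ S, (G.neighborSet v).ncard ≤ G.edgeSet.ncard}) ⟨0, ∅, rfl, by simp⟩ (ann_bdd G)

lemma iso_deg {V W : Type*} {G : SimpleGraph V} {H : SimpleGraph W} (e : G ≃g H) (v : V) :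
    (H.neighborSet (e v)).ncard = (G.neighborSet v).ncard := by
  have : H.neighborSet (e v) = e '' (G.neighborSet v) := by
    ext w
    obtain ⟨w, rfl⟩ := e.surjective w
    simp [e.map_adj_iff]
  rw [this, Set.ncard_image_of_injective _ e.injective]

lemma iso_edges {V W : Type*} [Finite V] {G : SimpleGraph V} {H : SimpleGraph W} (e : G ≃g H) :
    H.edgeSet.ncard = G.edgeSet.ncard := by
  have := Fintype.ofFinite V
  have : Fintype W := Fintype.ofEquiv V e.toEquiv
  have h1 := handshake_aux G
  have h2 := handshake_aux H
  rw [← Equiv.sum_comp e.toEquiv] at h2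
  have : ∑ v, (H.neighborSet (e.toEquiv v)).ncard = ∑ v, (G.neighborSet v).ncard :=
    Finset.sum_congr rfl fun v _ => iso_deg e v
  omega

lemma iso_td {V W : Type*} {G : SimpleGraph V} {H : SimpleGraph W} (e : G ≃g H)
    {D : Finset V} (hD : ∀ v, ∃ u ∈ D, G.Adj v u) :
    ∀ v, ∃ u ∈ D.map e.toEquiv.toEmbedding, H.Adj v u := by
  intro v
  obtain ⟨v, rfl⟩ := e.surjective v
  obtain ⟨u, hu, ha⟩ := hD v
  exact ⟨e u, Finset.mem_map_of_mem _ hu, e.map_adj_iff.2 ha⟩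

lemma iso_totalDomination {V W : Type*} {G : SimpleGraph V} {H : SimpleGraph W} (e : G ≃g H) :
    totalDominationNumber G = totalDominationNumber H := by
  unfold totalDominationNumber
  congr 1
  ext k
  constructor
  · rintro ⟨D, hD, rfl⟩
    exact ⟨_, iso_td e hD, by simp⟩
  · rintro ⟨D, hD, rfl⟩
    exact ⟨_, iso_td e.symm hD, by simp⟩

lemma iso_ann_le {V W : Type*} [Finite V] {G : SimpleGraph V} {H : SimpleGraph W} (e : G ≃g H) :
    annihilationNumber G ≤ annihilationNumber H := by
  have : Finite W := Finite.of_equiv V e.toEquiv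
  obtain ⟨S, hS, hs⟩ := ann_attained G
  have := le_ann H (S.map e.toEquiv.toEmbedding) (by
    rw [Finset.sum_map, iso_edges e]
    refine le_trans (le_of_eq ?_) hs
    exact Finset.sum_congr rfl fun v _ => iso_deg e v)
  simpa [hS] using this

/-! Adjacency in the extensions -/

lemma o1_ll (L : LGraph) (y a b : L.V) :
    (o1Ext L y).G.Adj (Sum.inl a) (Sum.inl b) ↔ L.G.Adj a b := by
  simp [o1Ext]

lemma o1_lr (L : LGraph) (y a : L.V) (i : Fin 4) :
    (o1Ext L y).G.Adj (Sum.inl a) (Sum.inr i) ↔ a = y ∧ i = 0 := by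
  simp [o1Ext]

lemma o1_rl (L : LGraph) (y a : L.V) (i : Fin 4) :
    (o1Ext L y).G.Adj (Sum.inr i) (Sum.inl a) ↔ a = y ∧ i = 0 := by
  exact (SimpleGraph.adj_comm _ _ _).trans (o1_lr L y a i)

lemma o1_rr (L : LGraph) (y : L.V) (i j : Fin 4) :
    (o1Ext L y).G.Adj (Sum.inr i) (Sum.inr j) ↔ (i : ℕ) + 1 = j ∨ (j : ℕ) + 1 = i := by
  fin_cases i <;> fin_cases j <;> simp [o1Ext]

lemma o2_ll (L : LGraph) (y a b : L.V) :
    (o2Ext L y).G.Adj (Sum.inl a) (Sum.inl b) ↔ L.G.Adj a b := by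
  simp [o2Ext]

lemma o2_lr (L : LGraph) (y a : L.V) (i : Fin 3) :
    (o2Ext L y).G.Adj (Sum.inl a) (Sum.inr i) ↔ a = y ∧ i = 0 := by
  simp [o2Ext]

lemma o2_rl (L : LGraph) (y a : L.V) (i : Fin 3) :
    (o2Ext L y).G.Adj (Sum.inr i) (Sum.inl a) ↔ a = y ∧ i = 0 := by
  exact (SimpleGraph.adj_comm _ _ _).trans (o2_lr L y a i)

lemma o2_rr (L : LGraph) (y : L.V) (i j : Fin 3) :
    (o2Ext L y).G.Adj (Sum.inr i) (Sum.inr j) ↔ (i : ℕ) + 1 = j ∨ (j : ℕ) + 1 = i := by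
  fin_cases i <;> fin_cases j <;> simp [o2Ext]

lemma at_ll {V : Type} (G : SimpleGraph V) (S : Set V) (a b : V) :
    (attachVertex G S).Adj (Sum.inl a) (Sum.inl b) ↔ G.Adj a b := by
  simp [attachVertex]

lemma at_lr {V : Type} (G : SimpleGraph V) (S : Set V) (a : V) :
    (attachVertex G S).Adj (Sum.inl a) (Sum.inr ()) ↔ a ∈ S := by
  simp [attachVertex]

lemma at_rl {V : Type} (G : SimpleGraph V) (S : Set V) (a : V) :
    (attachVertex G S).Adj (Sum.inr ()) (Sum.inl a) ↔ a ∈ S := by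
  rw [SimpleGraph.adj_comm, at_lr]

/-! Degrees -/

lemma ncard_fin_aux {n : ℕ} (p : Fin n → Prop) [DecidablePred p] :
    {i | p i}.ncard = (Finset.univ.filter p).card := by
  rw [← Set.ncard_coe_finset]; simp

open Classical in
lemma o1_deg_l (L : LGraph) [Finite L.V] (y a : L.V) :
    ((o1Ext L y).G.neighborSet (Sum.inl a)).ncard =
      (L.G.neighborSet a).ncard + if a = y then 1 else 0 := by
  have := ncard_sum_aux ((o1Ext L y).G.neighborSet (Sum.inl a))
  refine this.trans ?_
  congr 1
  · congr 1; ext b; exact o1_ll L y a b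
  · have : (Sum.inr ⁻¹' ((o1Ext L y).G.neighborSet (Sum.inl a)) : Set (Fin 4)) =
      {i | a = y ∧ i = 0} := by ext i; exact o1_lr L y a i
    rw [this]
    split_ifs with h <;> simp [h]

lemma o1_deg_r (L : LGraph) [Finite L.V] (y : L.V) (i : Fin 4) :
    ((o1Ext L y).G.neighborSet (Sum.inr i)).ncard = if i = 3 then 1 else 2 := by
  refine (ncard_sum_aux ((o1Ext L y).G.neighborSet (Sum.inr i))).trans ?_
  have h1 : (Sum.inl ⁻¹' ((o1Ext L y).G.neighborSet (Sum.inr i)) : Set L.V) =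
      {a | a = y ∧ i = 0} := by ext a; exact o1_rl L y a i
  have h2 : (Sum.inr ⁻¹' ((o1Ext L y).G.neighborSet (Sum.inr i)) : Set (Fin 4)) =
      {j : Fin 4 | (i : ℕ) + 1 = j ∨ (j : ℕ) + 1 = i} := by ext a; exact o1_rr L y i a
  rw [h1, h2, ncard_fin_aux]
  fin_cases i <;> simp <;> decide

open Classical in
lemma o2_deg_l (L : LGraph) [Finite L.V] (y a : L.V) :
    ((o2Ext L y).G.neighborSet (Sum.inl a)).ncard =
      (L.G.neighborSet a).ncard + if a = y then 1 else 0 := by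
  have := ncard_sum_aux ((o2Ext L y).G.neighborSet (Sum.inl a))
  refine this.trans ?_
  congr 1
  · congr 1; ext b; exact o2_ll L y a b
  · have : (Sum.inr ⁻¹' ((o2Ext L y).G.neighborSet (Sum.inl a)) : Set (Fin 3)) =
      {i | a = y ∧ i = 0} := by ext i; exact o2_lr L y a i
    rw [this]
    split_ifs with h <;> simp [h]

lemma o2_deg_r (L : LGraph) [Finite L.V] (y : L.V) (i : Fin 3) :
    ((o2Ext L y).G.neighborSet (Sum.inr i)).ncard = if i = 2 then 1 else 2 := by
  refine (ncard_sum_aux ((o2Ext L y).G.neighborSet (Sum.inr i))).trans ?_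
  have h1 : (Sum.inl ⁻¹' ((o2Ext L y).G.neighborSet (Sum.inr i)) : Set L.V) =
      {a | a = y ∧ i = 0} := by ext a; exact o2_rl L y a i
  have h2 : (Sum.inr ⁻¹' ((o2Ext L y).G.neighborSet (Sum.inr i)) : Set (Fin 3)) =
      {j : Fin 3 | (i : ℕ) + 1 = j ∨ (j : ℕ) + 1 = i} := by ext a; exact o2_rr L y i a
  rw [h1, h2, ncard_fin_aux]
  fin_cases i <;> simp <;> decide

open Classical in
lemma at_deg_l {V : Type} [Finite V] (G : SimpleGraph V) (S : Set V) (a : V) :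
    ((attachVertex G S).neighborSet (Sum.inl a)).ncard =
      (G.neighborSet a).ncard + if a ∈ S then 1 else 0 := by
  refine (ncard_sum_aux _).trans ?_
  congr 1
  · congr 1; ext b; exact at_ll G S a b
  · have : (Sum.inr ⁻¹' ((attachVertex G S).neighborSet (Sum.inl a)) : Set Unit) =
      {i | a ∈ S} := by ext i; exact at_lr G S a
    rw [this]
    split_ifs with h <;> simp [h]

lemma at_deg_r {V : Type} [Finite V] (G : SimpleGraph V) (S : Set V) (t : Unit) :
    ((attachVertex G S).neighborSet (Sum.inr t)).ncard = S.ncard := by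
  refine (ncard_sum_aux _).trans ?_
  have h1 : (Sum.inl ⁻¹' ((attachVertex G S).neighborSet (Sum.inr ())) : Set V) = S := by
    ext a; exact at_rl G S a
  have h2 : (Sum.inr ⁻¹' ((attachVertex G S).neighborSet (Sum.inr ())) : Set Unit) = ∅ := by
    ext a; simp
  rw [h1, h2]; simp

lemma o1_edges (L : LGraph) [Finite L.V] (y : L.V) :
    (o1Ext L y).G.edgeSet.ncard = L.G.edgeSet.ncard + 4 := by
  classical
  have := Fintype.ofFinite L.V
  have h1 := handshake_aux L.G
  have h2 := @handshake_aux _ (inferInstanceAs (Fintype (L.V ⊕ Fin 4))) (o1Ext L y).G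
  have h3 := Fintype.sum_sum_type
    (fun v : L.V ⊕ Fin 4 => ((o1Ext L y).G.neighborSet v).ncard)
  simp only [o1_deg_l, o1_deg_r, Finset.sum_add_distrib, Finset.sum_ite_eq', Finset.mem_univ,
    if_true, Fin.sum_univ_four] at h3
  have h4 := h2.symm.trans h3
  simp at h4
  omega

lemma o2_edges (L : LGraph) [Finite L.V] (y : L.V) :
    (o2Ext L y).G.edgeSet.ncard = L.G.edgeSet.ncard + 3 := by
  classical
  have := Fintype.ofFinite L.V
  have h1 := handshake_aux L.G
  have h2 := @handshake_aux _ (inferInstanceAs (Fintype (L.V ⊕ Fin 3))) (o2Ext L y).G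
  have h3 := Fintype.sum_sum_type
    (fun v : L.V ⊕ Fin 3 => ((o2Ext L y).G.neighborSet v).ncard)
  simp only [o2_deg_l, o2_deg_r, Finset.sum_add_distrib, Finset.sum_ite_eq', Finset.mem_univ,
    if_true, Fin.sum_univ_three] at h3
  have h4 := h2.symm.trans h3
  simp at h4
  omega

lemma at_edges {V : Type} [Finite V] (G : SimpleGraph V) (S : Set V) :
    (attachVertex G S).edgeSet.ncard = G.edgeSet.ncard + S.ncard := by
  classical
  have := Fintype.ofFinite V
  have h1 := handshake_aux G
  have h2 := handshake_aux (attachVertex G S)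
  have h5 : S.ncard = (Finset.univ.filter (· ∈ S)).card := by
    rw [← Set.ncard_coe_finset]; simp
  simp only [Fintype.sum_sum_type, at_deg_l, Finset.sum_add_distrib, Finset.univ_unique,
    Finset.sum_singleton, PUnit.default_eq_unit, at_deg_r, Finset.sum_boole] at h2
  simp only [Nat.cast_id] at h2
  omega

/-- The structural facts about members of `Γ` that are needed. -/
def GoodTree (V : Type) (G : SimpleGraph V) (sta : V → Status) : Prop :=
  Finite V ∧ ∃ k₁ k₂ : ℕ, G.edgeSet.ncard = 5 + 4 * k₁ + 3 * k₂ ∧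
    (∃ A : Finset V, 2 + k₂ ≤ A.card ∧
      ∀ v ∈ A, (G.neighborSet v).ncard = 1 ∧ sta v = Status.C) ∧
    (∃ B : Finset V, 4 + 4 * k₁ + k₂ ≤ B.card ∧ ∀ v ∈ B, (G.neighborSet v).ncard = 2) ∧
    ∀ c, sta c = Status.C → ∃ D : Finset V, c ∈ D ∧ (∀ v, ∃ u ∈ D, G.Adj v u) ∧
      D.card ≤ 4 + 2 * k₁ + 2 * k₂

lemma good_iso (L L' : LGraph) (h : LIso L L') (hg : GoodTree L.V L.G L.sta) :
    GoodTree L'.V L'.G L'.sta := by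
  obtain ⟨e, he⟩ := h
  obtain ⟨hf, k₁, k₂, hm, ⟨A, hA, hA'⟩, ⟨B, hB, hB'⟩, hD⟩ := hg
  refine ⟨Finite.of_equiv _ e.toEquiv, k₁, k₂, by rw [iso_edges e, hm],
    ⟨A.map e.toEquiv.toEmbedding, by simpa using hA, ?_⟩,
    ⟨B.map e.toEquiv.toEmbedding, by simpa using hB, ?_⟩, ?_⟩
  · intro v hv
    obtain ⟨v, hv', rfl⟩ := Finset.mem_map.1 hv
    exact ⟨(iso_deg e v).trans (hA' v hv').1, (he v).trans (hA' v hv').2⟩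
  · intro v hv
    obtain ⟨v, hv', rfl⟩ := Finset.mem_map.1 hv
    exact (iso_deg e v).trans (hB' v hv')
  · intro c hc
    obtain ⟨c, rfl⟩ := e.surjective c
    obtain ⟨D, h1, h2, h3⟩ := hD c (by rw [← he, hc])
    exact ⟨D.map e.toEquiv.toEmbedding, Finset.mem_map_of_mem _ h1, iso_td e h2,
      by simpa using h3⟩

lemma base_adj (i j : Fin 6) : baseT0.G.Adj i j ↔ ((i : ℕ) + 1 = j ∨ (j : ℕ) + 1 = i) := by
  simp only [baseT0, SimpleGraph.fromRel_adj]
  constructor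
  · exact fun h => h.2
  · refine fun h => ⟨?_, h⟩
    rintro rfl
    omega

lemma base_deg (i : Fin 6) :
    (baseT0.G.neighborSet i).ncard = if i = 0 ∨ i = 5 then 1 else 2 := by
  have h2 : (baseT0.G.neighborSet i : Set (Fin 6)) =
      {j : Fin 6 | (i : ℕ) + 1 = j ∨ (j : ℕ) + 1 = i} := by ext a; exact base_adj i a
  refine (congrArg Set.ncard h2).trans ?_
  refine (ncard_fin_aux (fun j : Fin 6 => (i : ℕ) + 1 = j ∨ (j : ℕ) + 1 = i)).trans ?_
  clear h2
  revert i
  decide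

lemma good_base : GoodTree baseT0.V baseT0.G baseT0.sta := by
  refine ⟨inferInstanceAs (Finite (Fin 6)), 0, 0, ?_,
    ⟨({0, 5} : Finset (Fin 6)), by decide, ?_⟩,
    ⟨({1, 2, 3, 4} : Finset (Fin 6)), by decide, ?_⟩, ?_⟩
  · have h := @handshake_aux _ (inferInstanceAs (Fintype (Fin 6))) baseT0.G
    have h2 : ∑ v : Fin 6, (baseT0.G.neighborSet v).ncard = 10 := by
      simp only [base_deg]; decide
    have := h.symm.trans h2
    omega
  · intro v hv
    refine ⟨(base_deg v).trans ?_, ?_⟩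
    · have key : ∀ v : Fin 6, v ∈ ({0, 5} : Finset (Fin 6)) →
          (if v = 0 ∨ v = 5 then 1 else 2) = 1 := by decide
      exact key v hv
    · have key : ∀ v : Fin 6, v ∈ ({0, 5} : Finset (Fin 6)) → baseT0.sta v = Status.C := by
        intro v hv
        fin_cases v <;> simp [baseT0] at hv ⊢
      exact key v hv
  · intro v hv
    have key : ∀ v : Fin 6, v ∈ ({1, 2, 3, 4} : Finset (Fin 6)) →
        (if v = 0 ∨ v = 5 then 1 else 2) = 2 := by decide
    exact (base_deg v).trans (key v hv)
  · intro c hc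
    refine ⟨({0, 1, 4, 5} : Finset (Fin 6)), ?_, ?_, by decide⟩
    · have key : ∀ c : Fin 6, baseT0.sta c = Status.C →
          c ∈ ({0, 1, 4, 5} : Finset (Fin 6)) := by
        intro c hc
        fin_cases c <;> simp [baseT0] at hc ⊢
      exact key c hc
    · have key : ∀ v : Fin 6, ∃ u ∈ ({0, 1, 4, 5} : Finset (Fin 6)),
          ((v : ℕ) + 1 = u ∨ (u : ℕ) + 1 = v) := by decide
      intro v
      obtain ⟨u, hu, h⟩ := key v
      exact ⟨u, hu, (base_adj v u).2 h⟩

lemma good_o1 (L : LGraph) (y : L.V) (hg : GoodTree L.V L.G L.sta)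
    (hsta : L.sta y = Status.C) (hleaf : (L.G.neighborSet y).ncard = 1) :
    GoodTree (L.V ⊕ Fin 4) (o1Ext L y).G (o1Ext L y).sta := by
  classical
  obtain ⟨hf, k₁, k₂, hm, ⟨A, hA, hA'⟩, ⟨B, hB, hB'⟩, hD⟩ := hg
  refine ⟨inferInstance, k₁ + 1, k₂, ?_, ⟨(A.erase y).disjSum {3}, ?_, ?_⟩,
    ⟨(insert y B).disjSum {0, 1, 2}, ?_, ?_⟩, ?_⟩
  · refine (o1_edges L y).trans ?_
    omega
  · have := Finset.pred_card_le_card_erase (a := y) (s := A)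
    simp only [Finset.card_disjSum, Finset.card_singleton]
    omega
  · rintro (v | i) hv
    · simp only [Finset.inl_mem_disjSum, Finset.mem_erase] at hv
      exact ⟨(o1_deg_l L y v).trans (by simp [hv.1, hA' v hv.2]), (hA' v hv.2).2⟩
    · simp only [Finset.inr_mem_disjSum, Finset.mem_singleton] at hv
      subst hv
      exact ⟨(o1_deg_r L y 3).trans (by simp), rfl⟩
  · have : y ∉ B := fun h => by have := hB' y h; omega
    simp [Finset.card_disjSum, this]
    omega
  · rintro (v | i) hv
    · refine (o1_deg_l L y v).trans ?_
      simp only [Finset.inl_mem_disjSum, Finset.mem_insert] at hv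
      rcases hv with rfl | hv
      · simp [hleaf]
      · have : v ≠ y := by rintro rfl; have := hB' v hv; omega
        simp [this, hB' v hv]
    · refine (o1_deg_r L y i).trans ?_
      simp only [Finset.inr_mem_disjSum] at hv
      revert i; decide
  · rintro (c | i) hc
    · obtain ⟨D, h1, h2, h3⟩ := hD c hc
      refine ⟨D.disjSum {1, 2}, by simpa using h1, ?_, ?_⟩
      · rintro (v | i)
        · obtain ⟨u, hu, h⟩ := h2 v
          exact ⟨Sum.inl u, by simpa using hu, (o1_ll L y v u).2 h⟩
        · have key : ∀ i : Fin 4, ∃ j ∈ ({1, 2} : Finset (Fin 4)),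
            ((i : ℕ) + 1 = j ∨ (j : ℕ) + 1 = i) := by decide
          obtain ⟨j, hj, h⟩ := key i
          exact ⟨Sum.inr j, by simpa using hj, (o1_rr L y i j).2 h⟩
      · simp [Finset.card_disjSum]; omega
    · have hi : i = 3 := by
        fin_cases i <;> simp [o1Ext] at hc ⊢
      subst hi
      obtain ⟨D, h1, h2, h3⟩ := hD y hsta
      refine ⟨D.disjSum {2, 3}, by simp, ?_, ?_⟩
      · rintro (v | i)
        · obtain ⟨u, hu, h⟩ := h2 v
          exact ⟨Sum.inl u, by simpa using hu, (o1_ll L y v u).2 h⟩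
        · by_cases hi : i = 0
          · subst hi
            exact ⟨Sum.inl y, by simpa using h1, (o1_rl L y y 0).2 ⟨rfl, rfl⟩⟩
          have key : ∀ i : Fin 4, i ≠ 0 → ∃ j ∈ ({2, 3} : Finset (Fin 4)),
            ((i : ℕ) + 1 = j ∨ (j : ℕ) + 1 = i) := by decide
          obtain ⟨j, hj, h⟩ := key i hi
          exact ⟨Sum.inr j, by simpa using hj, (o1_rr L y i j).2 h⟩
      · simp [Finset.card_disjSum]; omega

lemma good_o2 (L : LGraph) (y : L.V) (hg : GoodTree L.V L.G L.sta)
    (hsta : L.sta y = Status.B) :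
    GoodTree (L.V ⊕ Fin 3) (o2Ext L y).G (o2Ext L y).sta := by
  classical
  obtain ⟨hf, k₁, k₂, hm, ⟨A, hA, hA'⟩, ⟨B, hB, hB'⟩, hD⟩ := hg
  refine ⟨inferInstance, k₁, k₂ + 1, ?_, ⟨A.disjSum {2}, ?_, ?_⟩,
    ⟨(B.erase y).disjSum {0, 1}, ?_, ?_⟩, ?_⟩
  · refine (o2_edges L y).trans ?_
    omega
  · simp only [Finset.card_disjSum, Finset.card_singleton]
    omega
  · rintro (v | i) hv
    · simp only [Finset.inl_mem_disjSum] at hv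
      have : v ≠ y := by
        rintro rfl
        have := (hA' v hv).2
        simp [hsta] at this
      exact ⟨(o2_deg_l L y v).trans (by simp [this, hA' v hv]), (hA' v hv).2⟩
    · simp only [Finset.inr_mem_disjSum, Finset.mem_singleton] at hv
      subst hv
      exact ⟨(o2_deg_r L y 2).trans (by simp), rfl⟩
  · have := Finset.pred_card_le_card_erase (a := y) (s := B)
    simp [Finset.card_disjSum]
    omega
  · rintro (v | i) hv
    · refine (o2_deg_l L y v).trans ?_
      simp only [Finset.inl_mem_disjSum, Finset.mem_erase] at hv
      simp [hv.1, hB' v hv.2]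
    · refine (o2_deg_r L y i).trans ?_
      simp only [Finset.inr_mem_disjSum] at hv
      revert i; decide
  · have main : ∀ D : Finset L.V, (∀ v, ∃ u ∈ D, L.G.Adj v u) →
        ∀ v : L.V ⊕ Fin 3, ∃ u ∈ D.disjSum {1, 2}, (o2Ext L y).G.Adj v u := by
      rintro D h2 (v | i)
      · obtain ⟨u, hu, h⟩ := h2 v
        exact ⟨Sum.inl u, by simpa using hu, (o2_ll L y v u).2 h⟩
      · have key : ∀ i : Fin 3, ∃ j ∈ ({1, 2} : Finset (Fin 3)),
          ((i : ℕ) + 1 = j ∨ (j : ℕ) + 1 = i) := by decide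
        obtain ⟨j, hj, h⟩ := key i
        exact ⟨Sum.inr j, by simpa using hj, (o2_rr L y i j).2 h⟩
    rintro (c | i) hc
    · obtain ⟨D, h1, h2, h3⟩ := hD c hc
      refine ⟨D.disjSum {1, 2}, by simpa using h1, main D h2, ?_⟩
      simp [Finset.card_disjSum]; omega
    · have hi : i = 2 := by
        fin_cases i <;> simp [o2Ext] at hc ⊢
      subst hi
      have : A.Nonempty := by rw [← Finset.card_pos]; omega
      obtain ⟨a, ha⟩ := this
      obtain ⟨D, h1, h2, h3⟩ := hD a (hA' a ha).2
      refine ⟨D.disjSum {1, 2}, by simp, main D h2, ?_⟩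
      simp [Finset.card_disjSum]; omega

lemma good_of_gamma (L : LGraph) (h : InGamma L) : GoodTree L.V L.G L.sta := by
  induction h with
  | base L h => exact good_iso _ _ h good_base
  | op1 L y hL hsta hleaf L' h ih => exact good_iso _ _ h (good_o1 L y ih hsta hleaf)
  | op2 L y hL hsta L' h ih => exact good_iso _ _ h (good_o2 L y ih hsta)

/-- The quasi-tree under consideration. -/
def qGraph (T : LGraph) (y : T.V) (N₁ : Finset (Fin 4)) (N₂ : Finset T.V) :
    SimpleGraph ((T.V ⊕ Fin 4) ⊕ Unit) :=
  attachVertex (V := T.V ⊕ Fin 4) (o1Ext T y).G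
    (Sum.inr '' (N₁ : Set (Fin 4)) ∪ Sum.inl '' (N₂ : Set T.V))

lemma q_nbr_ncard {V : Type} [Finite V] (N₁ : Finset (Fin 4)) (N₂ : Finset V) :
    (Sum.inr '' (N₁ : Set (Fin 4)) ∪ Sum.inl '' (N₂ : Set V) : Set (V ⊕ Fin 4)).ncard =
      N₁.card + N₂.card := by
  have h1 : (Sum.inl ⁻¹' (Sum.inr '' (N₁ : Set (Fin 4)) ∪ Sum.inl '' (N₂ : Set V) :
      Set (V ⊕ Fin 4))) = (N₂ : Set V) := by ext; simp
  have h2 : (Sum.inr ⁻¹' (Sum.inr '' (N₁ : Set (Fin 4)) ∪ Sum.inl '' (N₂ : Set V) :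
      Set (V ⊕ Fin 4))) = (N₁ : Set (Fin 4)) := by ext; simp
  rw [ncard_sum_aux, h1, h2, Set.ncard_coe_finset, Set.ncard_coe_finset, add_comm]

lemma q_edges (T : LGraph) [Finite T.V] (y : T.V) (N₁ : Finset (Fin 4)) (N₂ : Finset T.V) :
    (qGraph T y N₁ N₂).edgeSet.ncard = T.G.edgeSet.ncard + 4 + (N₁.card + N₂.card) := by
  have h := at_edges (V := T.V ⊕ Fin 4) (o1Ext T y).G
    (Sum.inr '' (N₁ : Set (Fin 4)) ∪ Sum.inl '' (N₂ : Set T.V))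
  rw [q_nbr_ncard] at h
  exact h.trans (congrArg (· + (N₁.card + N₂.card)) (o1_edges T y))

open Classical in
lemma q_deg_l (T : LGraph) [Finite T.V] (y : T.V) (N₁ : Finset (Fin 4)) (N₂ : Finset T.V)
    (v : T.V) : ((qGraph T y N₁ N₂).neighborSet (Sum.inl (Sum.inl v))).ncard =
      (T.G.neighborSet v).ncard + (if v = y then 1 else 0) + (if v ∈ N₂ then 1 else 0) := by
  refine (at_deg_l _ _ _).trans ?_
  refine (congrArg (· + _) (o1_deg_l T y v)).trans ?_
  simp

open Classical in
lemma q_deg_r (T : LGraph) [Finite T.V] (y : T.V) (N₁ : Finset (Fin 4)) (N₂ : Finset T.V)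
    (i : Fin 4) : ((qGraph T y N₁ N₂).neighborSet (Sum.inl (Sum.inr i))).ncard =
      (if i = 3 then 1 else 2) + (if i ∈ N₁ then 1 else 0) := by
  refine (at_deg_l _ _ _).trans ?_
  refine (congrArg (· + _) (o1_deg_r T y i)).trans ?_
  simp

lemma q_deg_h (T : LGraph) [Finite T.V] (y : T.V) (N₁ : Finset (Fin 4)) (N₂ : Finset T.V)
    (t : Unit) : ((qGraph T y N₁ N₂).neighborSet (Sum.inr t)).ncard = N₁.card + N₂.card :=
  (at_deg_r _ _ t).trans (q_nbr_ncard N₁ N₂)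

open Classical in
lemma q_ann (T : LGraph) [Finite T.V] (y : T.V) (N₁ : Finset (Fin 4)) (N₂ : Finset T.V)
    (A : Finset T.V) (F : Finset (Fin 4)) (U : Finset Unit)
    (h : ∑ v ∈ A, (T.G.neighborSet v).ncard + (if y ∈ A then 1 else 0) + (A ∩ N₂).card +
      ∑ i ∈ F, ((if i = 3 then 1 else 2) + (if i ∈ N₁ then 1 else 0)) +
      U.card * (N₁.card + N₂.card) ≤ T.G.edgeSet.ncard + 4 + (N₁.card + N₂.card)) :
    A.card + F.card + U.card ≤ annihilationNumber (qGraph T y N₁ N₂) := by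
  have := le_ann (qGraph T y N₁ N₂) ((A.disjSum F).disjSum U) (by
    rw [Finset.sum_disjSum, Finset.sum_disjSum, q_edges]
    simp only [q_deg_l, q_deg_r, q_deg_h, Finset.sum_add_distrib, Finset.sum_const,
      Finset.sum_ite_eq', Finset.sum_boole, Finset.filter_mem_eq_inter, smul_eq_mul,
      Nat.cast_id, mul_add] at h ⊢
    omega)
  simpa [Finset.card_disjSum] using this

lemma q_td (T : LGraph) (y : T.V) (N₁ : Finset (Fin 4)) (N₂ : Finset T.V)
    (D : Finset T.V) (U : Finset Unit)
    (hD : ∀ v, ∃ u ∈ D.disjSum U, (attachVertex T.G (N₂ : Set T.V)).Adj v u) :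
    totalDominationNumber (qGraph T y N₁ N₂) ≤ D.card + U.card + 2 := by
  have h : ∀ v, ∃ u ∈ ((D.disjSum {1, 2}).disjSum U : Finset ((T.V ⊕ Fin 4) ⊕ Unit)),
      (qGraph T y N₁ N₂).Adj v u := by
    rintro ((v | i) | ⟨⟩)
    · obtain ⟨u | ⟨⟩, hu, h⟩ := hD (Sum.inl v)
      · refine ⟨Sum.inl (Sum.inl u), by simpa using hu, ?_⟩
        exact (at_ll _ _ _ _).2 ((o1_ll T y v u).2 ((at_ll _ _ _ _).1 h))
      · refine ⟨Sum.inr (), by simpa using hu, (at_lr _ _ _).2 ?_⟩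
        have := (at_lr _ _ _).1 h
        simpa using this
    · have key : ∀ i : Fin 4, ∃ j ∈ ({1, 2} : Finset (Fin 4)),
        ((i : ℕ) + 1 = j ∨ (j : ℕ) + 1 = i) := by decide
      obtain ⟨j, hj, h⟩ := key i
      refine ⟨Sum.inl (Sum.inr j), by simpa using hj, ?_⟩
      exact (at_ll _ _ _ _).2 ((o1_rr T y i j).2 h)
    · obtain ⟨u | ⟨⟩, hu, h⟩ := hD (Sum.inr ())
      · refine ⟨Sum.inl (Sum.inl u), by simpa using hu, (at_rl _ _ _).2 ?_⟩
        have := (at_rl _ _ _).1 h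
        simpa using this
      · exact absurd h (SimpleGraph.irrefl _)
  have := td_le _ _ h
  simp [Finset.card_disjSum] at this
  omega

/-- The induced subgraph is the tree with the extra vertex attached. -/
lemma q_iso (T : LGraph) (y : T.V) (N₁ : Finset (Fin 4)) (N₂ : Finset T.V) :
    Nonempty (attachVertex T.G (N₂ : Set T.V) ≃g (qGraph T y N₁ N₂).induce
        {u | u ∉ ({Sum.inl (Sum.inr 0), Sum.inl (Sum.inr 1), Sum.inl (Sum.inr 2),
          Sum.inl (Sum.inr 3)} : Set ((T.V ⊕ Fin 4) ⊕ Unit))}) := by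
  let f : T.V ⊕ Unit → {u : (T.V ⊕ Fin 4) ⊕ Unit |
      u ∉ ({Sum.inl (Sum.inr 0), Sum.inl (Sum.inr 1), Sum.inl (Sum.inr 2),
          Sum.inl (Sum.inr 3)} : Set ((T.V ⊕ Fin 4) ⊕ Unit))} :=
    fun p => ⟨Sum.map Sum.inl id p, by rcases p with v | v <;> simp⟩
  have hf : Function.Bijective f := by
    constructor
    · rintro (a | a) (b | b) h <;> simp [f] at h ⊢ <;> exact h
    · rintro ⟨(a | i) | ⟨⟩, h⟩
      · exact ⟨Sum.inl a, rfl⟩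
      · exfalso
        fin_cases i <;> simp at h
      · exact ⟨Sum.inr (), rfl⟩
  refine ⟨⟨Equiv.ofBijective f hf, ?_⟩⟩
  rintro (a | ⟨⟩) (b | ⟨⟩)
  · exact (at_ll _ _ _ _).trans ((o1_ll T y a b).trans (at_ll _ _ _ _).symm)
  · refine (at_lr _ _ _).trans (Iff.trans ?_ (at_lr _ _ _).symm)
    simp
  · refine (at_rl _ _ _).trans (Iff.trans ?_ (at_rl _ _ _).symm)
    simp
  · exact iff_of_false (SimpleGraph.irrefl _) (SimpleGraph.irrefl _)

/-- The case treated directly, without the induction hypothesis. -/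
lemma q_direct (T : LGraph) (y : T.V) (hT : InGamma T) (hy : T.sta y = Status.C)
    (hleaf : (T.G.neighborSet y).ncard = 1) (N₁ : Finset (Fin 4)) (ht₁ : 1 ≤ N₁.card)
    (u : T.V) (huy : u ≠ y) (h0 : (0 : Fin 4) ∉ N₁) :
    totalDominationNumber (qGraph T y N₁ {u}) ≤
      annihilationNumber (qGraph T y N₁ {u}) + 1 := by
  classical
  obtain ⟨hf, k₁, k₂, hm, ⟨A, hA, hA'⟩, ⟨B, hB, hB'⟩, hD⟩ := good_of_gamma T hT
  have hBc := Finset.pred_card_le_card_erase (a := u) (s := B)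
  obtain ⟨M, hM, hMc⟩ := Finset.exists_subset_card_eq
    (s := B.erase u) (n := 3 + 2 * k₁ + k₂) (by omega)
  have hM1 : ∀ v ∈ M, (T.G.neighborSet v).ncard = 2 ∧ v ≠ u := fun v hv => by
    have := Finset.mem_erase.1 (hM hv)
    exact ⟨hB' v this.2, this.1⟩
  -- a lower bound on the annihilation number
  have ann : ∀ (P : Finset T.V), P ⊆ (A.erase y).erase u → P.card ≤ k₂ + 1 →
      P.card + k₂ + 2 * k₁ + 5 ≤ annihilationNumber (qGraph T y N₁ {u}) := by
    intro P hP hPc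
    have hP1 : ∀ v ∈ P, (T.G.neighborSet v).ncard = 1 ∧ v ≠ u ∧ v ≠ y := fun v hv => by
      have h1 := Finset.mem_erase.1 (hP hv)
      have h2 := Finset.mem_erase.1 h1.2
      exact ⟨(hA' v h2.2).1, h1.1, h2.1⟩
    have hPM : Disjoint P M := by
      rw [Finset.disjoint_left]
      intro v h1 h2
      have := (hP1 v h1).1
      have := (hM1 v h2).1
      omega
    have hyPM : y ∉ P ∪ M := by
      intro h
      rcases Finset.mem_union.1 h with h | h
      · exact (hP1 y h).2.2 rfl
      · have := (hM1 y h).1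
        omega
    have huI : insert y (P ∪ M) ∩ {u} = ∅ := by
      ext v
      simp only [Finset.mem_inter, Finset.mem_insert, Finset.mem_union, Finset.mem_singleton,
        Finset.notMem_empty, iff_false]
      rintro ⟨rfl | h | h, rfl⟩
      · exact huy rfl
      · exact (hP1 v h).2.1 rfl
      · exact (hM1 v h).2 rfl
    have := q_ann T y N₁ {u} (insert y (P ∪ M)) {0} ∅ (by
      rw [huI, Finset.sum_insert hyPM, Finset.sum_union hPM,
        Finset.sum_congr rfl (fun v hv => (hP1 v hv).1),
        Finset.sum_congr rfl (fun v hv => (hM1 v hv).1)]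
      simp [h0, hleaf]
      omega)
    rw [Finset.card_insert_of_notMem hyPM, Finset.card_union_of_disjoint hPM] at this
    simp at this
    omega
  have hAc := Finset.pred_card_le_card_erase (a := y) (s := A)
  by_cases hu : T.sta u = Status.C
  · obtain ⟨D, h1, h2, h3⟩ := hD u hu
    have hAc2 := Finset.pred_card_le_card_erase (a := u) (s := A.erase y)
    obtain ⟨P, hP, hPc⟩ := Finset.exists_subset_card_eq
      (s := (A.erase y).erase u) (n := k₂) (by omega)
    have ha := ann P hP (by omega)
    have ht := q_td T y N₁ {u} D ∅ (by
      rintro (v | ⟨⟩)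
      · obtain ⟨w, hw, h⟩ := h2 v
        exact ⟨Sum.inl w, by simpa using hw, (at_ll _ _ _ _).2 h⟩
      · exact ⟨Sum.inl u, by simpa using h1, (at_rl _ _ _).2 (by simp)⟩)
    simp at ht
    omega
  · obtain ⟨D, h1, h2, h3⟩ := hD y hy
    have huA : u ∉ A.erase y := fun h => hu (hA' u (Finset.mem_of_mem_erase h)).2
    have he : (A.erase y).erase u = A.erase y := Finset.erase_eq_of_notMem huA
    obtain ⟨P, hP, hPc⟩ := Finset.exists_subset_card_eq
      (s := (A.erase y).erase u) (n := k₂ + 1) (by rw [he]; omega)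
    have ha := ann P hP (by omega)
    have ht := q_td T y N₁ {u} (insert u D) ∅ (by
      rintro (v | ⟨⟩)
      · obtain ⟨w, hw, h⟩ := h2 v
        exact ⟨Sum.inl w, by simp [hw], (at_ll _ _ _ _).2 h⟩
      · exact ⟨Sum.inl u, by simp, (at_rl _ _ _).2 (by simp)⟩)
    have := Finset.card_insert_le u D
    simp at ht
    omega

/-- The case treated by extending an optimal set of the induced subgraph. -/
lemma q_extend (T : LGraph) [Finite T.V] (y : T.V) 
    (hleaf : (T.G.neighborSet y).ncard = 1) (N₁ : Finset (Fin 4))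
    (N₂ : Finset T.V) (ht₂ : 1 ≤ N₂.card)
    (hc : (0 : Fin 4) ∈ N₁ ∨ 2 ≤ N₂.card ∨ N₂ = {y}) :
    annihilationNumber (attachVertex T.G (N₂ : Set T.V)) + 2 ≤
      annihilationNumber (qGraph T y N₁ N₂) := by
  classical
  obtain ⟨S, hS, hs⟩ := ann_attained (attachVertex T.G (N₂ : Set T.V))
  obtain ⟨A, U, rfl⟩ : ∃ A U, S = Finset.disjSum A U :=
    ⟨S.toLeft, S.toRight, Finset.toLeft_disjSum_toRight.symm⟩
  rw [Finset.sum_disjSum, at_edges, Set.ncard_coe_finset] at hs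
  simp only [at_deg_l, at_deg_r, Finset.sum_add_distrib, Finset.sum_const, smul_eq_mul,
    Finset.mem_coe, Finset.sum_boole, Finset.filter_mem_eq_inter, Nat.cast_id,
    Set.ncard_coe_finset] at hs
  rw [Finset.card_disjSum] at hS
  have hN : N₁.card = (if (0 : Fin 4) ∈ N₁ then 1 else 0) + (if (1 : Fin 4) ∈ N₁ then 1 else 0) +
      (if (2 : Fin 4) ∈ N₁ then 1 else 0) + (if (3 : Fin 4) ∈ N₁ then 1 else 0) := by
    have := Fin.sum_univ_four (fun i : Fin 4 => if i ∈ N₁ then 1 else 0)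
    rw [← this]
    simp
  have hU : U.card = 0 ∨ U.card = 1 := by
    have := Finset.card_le_univ U
    simp at this
    omega
  have e1 : ∑ i ∈ ({1, 3} : Finset (Fin 4)),
      ((if i = 3 then 1 else 2) + (if i ∈ N₁ then 1 else 0)) =
      3 + ((if (1 : Fin 4) ∈ N₁ then 1 else 0) + (if (3 : Fin 4) ∈ N₁ then 1 else 0)) := by
    simp; omega
  have e2 : ∑ i ∈ ({1, 2, 3} : Finset (Fin 4)),
      ((if i = 3 then 1 else 2) + (if i ∈ N₁ then 1 else 0)) =
      5 + ((if (1 : Fin 4) ∈ N₁ then 1 else 0) + (if (2 : Fin 4) ∈ N₁ then 1 else 0) +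
        (if (3 : Fin 4) ∈ N₁ then 1 else 0)) := by
    simp; omega
  have e3 : ∑ i : Fin 4,
      ((if i = 3 then 1 else 2) + (if i ∈ N₁ then 1 else 0)) = 7 + N₁.card := by
    rw [hN, Fin.sum_univ_four]; simp; omega
  have hy1 : (if y ∈ A then 1 else 0) ≤ 1 := by split_ifs <;> omega
  rcases hU with hU | hU
  · have := q_ann T y N₁ N₂ A {1, 3} ∅ (by
      rw [e1]
      simp only [hU, zero_mul, Finset.card_empty] at hs ⊢
      omega)
    simp at this
    omega
  · by_cases hgood : y ∉ A ∨ (0 : Fin 4) ∈ N₁ ∨ 2 ≤ N₂.card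
    · have := q_ann T y N₁ N₂ A {1, 2, 3} ∅ (by
        rw [e2]
        simp only [hU, one_mul, zero_mul, Finset.card_empty] at hs ⊢
        rcases hgood with h | h | h
        · rw [if_neg h]; omega
        · rw [if_pos h] at hN; omega
        · omega)
      simp at this
      omega
    · push Not at hgood
      obtain ⟨g1, g2, g3⟩ := hgood
      have hNy : N₂ = {y} := by
        rcases hc with h | h | h
        · exact absurd h g2
        · omega
        · exact h
      subst hNy
      have hsum := Finset.add_sum_erase A (fun v => (T.G.neighborSet v).ncard) g1
      have hi : A ∩ {y} = {y} := by simp [g1]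
      have hi2 : A.erase y ∩ {y} = ∅ := by simp
      have hcard := Finset.card_erase_add_one g1
      have := q_ann T y N₁ {y} (A.erase y) Finset.univ ∅ (by
        rw [e3, hi2]
        rw [hi] at hs
        simp only [hU, one_mul, zero_mul, Finset.card_empty, Finset.mem_erase, ne_eq,
          not_true_eq_false, false_and, if_false, Finset.card_singleton] at hs ⊢
        omega)
      simp at this
      omega

end Helpers

/-- Let `G ∈ QT₅`, i.e. `G` is obtained from a tree `T' = o1Ext T y ∈ Γ₁`
(where `T ∈ Γ`, `y` is a leaf of `T` of status `C`, and `x, w, v, z` are the vertices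
added in the last step) and a new vertex `h` by adding `t₁ ≥ 1` edges between `h` and
`{x, w, v, z}` and `t₂ ≥ 1` edges between `h` and `V(T') \ {x, w, v, z}`. If
`G' = G[V(G) \ {x, w, v, z}]` satisfies `γₜ(G') ≤ a(G') + 1`, then
`γₜ(G) ≤ a(G) + 1`. -/
theorem stmt_5 (T : LGraph) (y : T.V)
    (hT : InGamma T) (hy : T.sta y = Status.C) (hleaf : (T.G.neighborSet y).ncard = 1)
    (N₁ : Finset (Fin 4)) (ht₁ : 1 ≤ N₁.card)
    (N₂ : Finset T.V) (ht₂ : 1 ≤ N₂.card)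
    (G : SimpleGraph ((T.V ⊕ Fin 4) ⊕ Unit))
    (hG : G = attachVertex (o1Ext T y).G
      (Sum.inr '' (N₁ : Set (Fin 4)) ∪ Sum.inl '' (N₂ : Set T.V)))
    (h' :
      totalDominationNumber (G.induce
        {u | u ∉ ({Sum.inl (Sum.inr 0), Sum.inl (Sum.inr 1), Sum.inl (Sum.inr 2),
          Sum.inl (Sum.inr 3)} : Set ((T.V ⊕ Fin 4) ⊕ Unit))}) ≤
      annihilationNumber (G.induce
        {u | u ∉ ({Sum.inl (Sum.inr 0), Sum.inl (Sum.inr 1), Sum.inl (Sum.inr 2),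
          Sum.inl (Sum.inr 3)} : Set ((T.V ⊕ Fin 4) ⊕ Unit))}) + 1) :
    totalDominationNumber G ≤ annihilationNumber G + 1 := by
  classical
  have hG' : G = qGraph T y N₁ N₂ := hG
  clear hG
  subst hG'
  have hf : Finite T.V := (good_of_gamma T hT).1
  obtain ⟨e⟩ := q_iso T y N₁ N₂
  by_cases hc : (0 : Fin 4) ∈ N₁ ∨ 2 ≤ N₂.card ∨ N₂ = {y}
  · have h1 := q_extend T y hleaf N₁ N₂ ht₂ hc
    have h2 := iso_totalDomination e
    have h3 := iso_ann_le e.symm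
    obtain ⟨_, k₁, k₂, -, -, -, hD⟩ := good_of_gamma T hT
    obtain ⟨D, -, hD, -⟩ := hD y hy
    obtain ⟨u, hu⟩ : N₂.Nonempty := Finset.card_pos.1 ht₂
    obtain ⟨D', hD', hc'⟩ := td_attained (attachVertex T.G (N₂ : Set T.V))
      ((insert u D).disjSum ∅) (by
      rintro (v | ⟨⟩)
      · obtain ⟨w, hw, h⟩ := hD v
        exact ⟨Sum.inl w, by simp [hw], (at_ll _ _ _ _).2 h⟩
      · exact ⟨Sum.inl u, by simp, (at_rl _ _ _).2 (by simpa using hu)⟩)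
    obtain ⟨A, U, rfl⟩ : ∃ A U, D' = Finset.disjSum A U :=
      ⟨D'.toLeft, D'.toRight, Finset.toLeft_disjSum_toRight.symm⟩
    have h4 := q_td T y N₁ N₂ A U hD'
    rw [Finset.card_disjSum] at hc'
    omega
  · push Not at hc
    obtain ⟨c1, c2, c3⟩ := hc
    obtain ⟨u, rfl⟩ := Finset.card_eq_one.1 (show N₂.card = 1 by omega)
    exact q_direct T y hT hy hleaf N₁ ht₁ u (fun h => c3 (by rw [h])) c1
end

section
/- Let G ∈ QT_6 and let G' = G[V(G) \ {x, w, v}] be the subgraph of G induced by all vertices except x, w, v. If γ_t(G') ≤ a(G') + 1, then γ_t(G) ≤ a(G) + 1. -/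
open SimpleGraph

lemma edge_lb {V W : Type} [Finite W] (G : SimpleGraph V) (f : V ↪ W) (F : Set (Sym2 W))
    (hF : ∀ e ∈ F, ¬ e.IsDiag ∧ ∃ b ∈ e, b ∉ Set.range f) :
    G.edgeSet.ncard + F.ncard ≤ (G.map f ⊔ SimpleGraph.fromEdgeSet F).edgeSet.ncard := by
  have hd : Disjoint (f.sym2Map '' G.edgeSet) F := by
    rw [Set.disjoint_left]
    rintro _ ⟨e, _, rfl⟩ he
    obtain ⟨_, b, hb, hbr⟩ := hF _ he
    induction e with
    | _ p q =>
      simp only [Function.Embedding.sym2Map_apply, Sym2.map_mk, Sym2.mem_iff] at hb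
      rcases hb with rfl | rfl <;> exact hbr ⟨_, rfl⟩
  rw [← Set.ncard_image_of_injective G.edgeSet f.sym2Map.injective,
    ← Set.ncard_union_eq hd (Set.toFinite _) (Set.toFinite _)]
  apply Set.ncard_le_ncard _ (Set.toFinite _)
  rw [SimpleGraph.edgeSet_sup, SimpleGraph.edgeSet_fromEdgeSet, SimpleGraph.edgeSet_map]
  apply Set.union_subset_union_right
  intro e he
  exact ⟨he, (hF e he).1⟩

/-- The invariant on labeled graphs. -/
def GInv (L : LGraph) : Prop :=
  Finite L.V ∧ ∃ D S : Finset L.V, (∀ v, ∃ u ∈ D, L.G.Adj v u) ∧ D.card ≤ S.card ∧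
    S.Nonempty ∧ (∀ s ∈ S, L.sta s ≠ Status.B) ∧
    ∑ v ∈ S, (L.G.neighborSet v).ncard ≤ L.G.edgeSet.ncard + 1

lemma GInv.iso {L L' : LGraph} (h : LIso L L') (hL : GInv L) : GInv L' := by
  obtain ⟨e, he⟩ := h
  obtain ⟨hf, D, S, hD, hc, hne, hB, hs⟩ := hL
  have hf' : Finite L'.V := Finite.of_equiv _ e.toEquiv
  refine ⟨hf', D.map e.toEquiv.toEmbedding, S.map e.toEquiv.toEmbedding, ?_, by simpa using hc,
    by simpa using hne, ?_, ?_⟩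
  · intro v
    obtain ⟨u, hu, hvu⟩ := hD (e.symm v)
    refine ⟨e u, Finset.mem_map.2 ⟨u, hu, rfl⟩, ?_⟩
    have := e.map_adj_iff.2 hvu
    simpa using this
  · intro s hs
    simp only [Finset.mem_map] at hs
    obtain ⟨a, ha, rfl⟩ := hs
    have := hB a ha
    rw [← he a] at this
    exact this
  · rw [Finset.sum_map]
    have h1 : L.G.edgeSet.ncard = L'.G.edgeSet.ncard := Nat.card_congr e.mapEdgeSet
    rw [← h1]
    refine le_trans (le_of_eq ?_) hs
    refine Finset.sum_congr rfl fun v _ => ?_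
    exact (Nat.card_congr (e.mapNeighborSet v)).symm

lemma inv_base : GInv baseT0 := by
  refine ⟨inferInstanceAs (Finite (Fin 6)), ?_⟩
  show ∃ D S : Finset (Fin 6), _
  refine ⟨({1, 2, 3, 4} : Finset (Fin 6)), ({0, 1, 4, 5} : Finset (Fin 6)), ?_, by decide,
    ⟨(0 : Fin 6), Finset.mem_insert_self (0 : Fin 6) {1, 4, 5}⟩, ?_, ?_⟩
  · show ∀ v : Fin 6, ∃ u ∈ ({1, 2, 3, 4} : Finset (Fin 6)),
      (SimpleGraph.fromRel (fun i j : Fin 6 => (i : ℕ) + 1 = (j : ℕ))).Adj v u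
    simp only [SimpleGraph.fromRel_adj]
    decide
  · show ∀ s ∈ ({0, 1, 4, 5} : Finset (Fin 6)),
      (![Status.C, Status.A, Status.B, Status.B, Status.A, Status.C] : Fin 6 → Status) s ≠ Status.B
    intro s hs
    fin_cases s <;> simp_all
  · show ∑ v ∈ ({0, 1, 4, 5} : Finset (Fin 6)),
      ((SimpleGraph.fromRel (fun i j : Fin 6 => (i : ℕ) + 1 = (j : ℕ))).neighborSet v).ncard ≤
      (SimpleGraph.fromRel (fun i j : Fin 6 => (i : ℕ) + 1 = (j : ℕ))).edgeSet.ncard + 1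
    set G := (SimpleGraph.fromRel (fun i j : Fin 6 => (i : ℕ) + 1 = (j : ℕ))) with hG
    have key : ∀ (v : Fin 6) (t : Finset (Fin 6)), (∀ u, G.Adj v u → u ∈ t) →
        (G.neighborSet v).ncard ≤ t.card := by
      intro v t h
      rw [← Set.ncard_coe_finset]
      exact Set.ncard_le_ncard (fun u hu => h u hu) (Set.toFinite _)
    have h0 := key 0 {1} (by simp only [hG, SimpleGraph.fromRel_adj]; decide)
    have h1 := key 1 {0, 2} (by simp only [hG, SimpleGraph.fromRel_adj]; decide)
    have h4 := key 4 {3, 5} (by simp only [hG, SimpleGraph.fromRel_adj]; decide)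
    have h5 := key 5 {4} (by simp only [hG, SimpleGraph.fromRel_adj]; decide)
    have hm : 5 ≤ G.edgeSet.ncard := by
      have : (({s(0,1), s(1,2), s(2,3), s(3,4), s(4,5)} : Finset (Sym2 (Fin 6))) :
          Set (Sym2 (Fin 6))).ncard = 5 := by
        rw [Set.ncard_coe_finset]; decide
      rw [← this]
      apply Set.ncard_le_ncard _ (Set.toFinite _)
      intro e he
      simp only [Finset.coe_insert, Finset.coe_singleton, Set.mem_insert_iff,
        Set.mem_singleton_iff] at he
      rcases he with rfl | rfl | rfl | rfl | rfl <;> simp [hG]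
    have hsum : ∑ v ∈ ({0, 1, 4, 5} : Finset (Fin 6)), (G.neighborSet v).ncard =
      (G.neighborSet 0).ncard + ((G.neighborSet 1).ncard + ((G.neighborSet 4).ncard +
        (G.neighborSet 5).ncard)) := by
      rw [Finset.sum_insert (by decide), Finset.sum_insert (by decide),
        Finset.sum_insert (by decide), Finset.sum_singleton]
    have e1 : ({0, 2} : Finset (Fin 6)).card = 2 := by decide
    have e2 : ({3, 5} : Finset (Fin 6)).card = 2 := by decide
    simp only [Finset.card_singleton, e1, e2] at *
    omega

/-- The underlying graph of `o1Ext`. -/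
abbrev o1G {V : Type} (G : SimpleGraph V) (y : V) : SimpleGraph (V ⊕ Fin 4) :=
  (G.map Function.Embedding.inl) ⊔
    SimpleGraph.fromEdgeSet
      {s(Sum.inl y, Sum.inr 0), s(Sum.inr 0, Sum.inr 1),
       s(Sum.inr 1, Sum.inr 2), s(Sum.inr 2, Sum.inr 3)}

/-- The underlying graph of `o2Ext`. -/
abbrev o2G {V : Type} (G : SimpleGraph V) (y : V) : SimpleGraph (V ⊕ Fin 3) :=
  (G.map Function.Embedding.inl) ⊔
    SimpleGraph.fromEdgeSet
      {s(Sum.inl y, Sum.inr 0), s(Sum.inr 0, Sum.inr 1), s(Sum.inr 1, Sum.inr 2)}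

lemma deg_le_one {W : Type} [Finite W] (G : SimpleGraph W) (u a : W)
    (h : ∀ c, G.Adj u c → c = a) : (G.neighborSet u).ncard ≤ 1 := by
  rw [← Set.ncard_singleton a]
  exact Set.ncard_le_ncard (fun c hc => h c hc) (Set.toFinite _)

lemma deg_le_two {W : Type} [Finite W] (G : SimpleGraph W) (u a b : W)
    (h : ∀ c, G.Adj u c → c = a ∨ c = b) : (G.neighborSet u).ncard ≤ 2 := by
  have h1 : ({a, b} : Set W).ncard ≤ 2 := by
    have := Set.ncard_insert_le a ({b} : Set W)
    rwa [Set.ncard_singleton] at this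
  exact (Set.ncard_le_ncard (fun c hc => h c hc) (Set.toFinite _)).trans h1

open Classical in
lemma deg_inl {V W : Type} [Finite V] [Finite W] (G : SimpleGraph V) (K : SimpleGraph (V ⊕ W))
    (u : V) (P : Prop) (c : W) (h1 : ∀ a, K.Adj (Sum.inl u) (Sum.inl a) → G.Adj u a)
    (h2 : ∀ a, K.Adj (Sum.inl u) (Sum.inr a) → P ∧ a = c) :
    (K.neighborSet (Sum.inl u)).ncard ≤ (G.neighborSet u).ncard + if P then 1 else 0 := by
  have hsub : K.neighborSet (Sum.inl u) ⊆
      (Sum.inl '' G.neighborSet u) ∪ (if P then {Sum.inr c} else ∅ : Set (V ⊕ W)) := by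
    rintro (a | a) ha
    · left; exact ⟨a, h1 a ha, rfl⟩
    · right
      simp [h2 a ha]
  refine (Set.ncard_le_ncard hsub (Set.toFinite _)).trans
    ((Set.ncard_union_le _ _).trans (Nat.add_le_add (Set.ncard_image_le (Set.toFinite _)) ?_))
  split_ifs <;> simp

open Classical in
lemma o1_deg {V : Type} [Finite V] (G : SimpleGraph V) (y u : V) :
    ((o1G G y).neighborSet (Sum.inl u)).ncard ≤
      (G.neighborSet u).ncard + if y = u then 1 else 0 := by
  apply deg_inl G _ u _ 0
  · intro a h; simpa using h
  · intro a h; simp at h; exact ⟨h.1.symm, h.2⟩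

lemma o1_deg2 {V : Type} [Finite V] (G : SimpleGraph V) (y : V) :
    ((o1G G y).neighborSet (Sum.inr 2)).ncard ≤ 2 := by
  apply deg_le_two _ _ (Sum.inr 1) (Sum.inr 3)
  rintro (a | a) ha
  · simp at ha
  · fin_cases a <;> simp_all

lemma o1_deg3 {V : Type} [Finite V] (G : SimpleGraph V) (y : V) :
    ((o1G G y).neighborSet (Sum.inr 3)).ncard ≤ 1 := by
  apply deg_le_one _ _ (Sum.inr 2)
  rintro (a | a) ha
  · simp at ha
  · fin_cases a <;> simp_all

lemma o2_deg {V : Type} [Finite V] (G : SimpleGraph V) (y u : V) (h : y ≠ u) :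
    ((o2G G y).neighborSet (Sum.inl u)).ncard ≤ (G.neighborSet u).ncard := by
  classical
  have := deg_inl G (o2G G y) u (y = u) 0 (fun a h => by simpa using h)
    (fun a h => by simp at h; exact ⟨h.1.symm, h.2⟩)
  rwa [if_neg h] at this

lemma o2_deg1 {V : Type} [Finite V] (G : SimpleGraph V) (y : V) :
    ((o2G G y).neighborSet (Sum.inr 1)).ncard ≤ 2 := by
  apply deg_le_two _ _ (Sum.inr 0) (Sum.inr 2)
  rintro (a | a) ha
  · simp at ha
  · fin_cases a <;> simp_all

lemma o2_deg2 {V : Type} [Finite V] (G : SimpleGraph V) (y : V) :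
    ((o2G G y).neighborSet (Sum.inr 2)).ncard ≤ 1 := by
  apply deg_le_one _ _ (Sum.inr 1)
  rintro (a | a) ha
  · simp at ha
  · fin_cases a <;> simp_all

lemma inv_o1 (L : LGraph) (y : L.V) (hL : GInv L) : GInv (o1Ext L y) := by
  classical
  obtain ⟨hf, D, S, hD, hc, hne, hB, hs⟩ := hL
  have hf' : Finite (o1Ext L y).V := inferInstanceAs (Finite (L.V ⊕ Fin 4))
  refine ⟨hf', D.disjSum ({1, 2} : Finset (Fin 4)), S.disjSum ({2, 3} : Finset (Fin 4)), ?_, ?_, ?_, ?_, ?_⟩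
  · rintro (v | v)
    · obtain ⟨u, hu, hvu⟩ := hD v
      exact ⟨Sum.inl u, Finset.inl_mem_disjSum.2 hu, by simp [o1Ext, hvu]⟩
    · fin_cases v
      · exact ⟨Sum.inr 1, Finset.inr_mem_disjSum.2 (by simp), by simp [o1Ext]⟩
      · exact ⟨Sum.inr 2, Finset.inr_mem_disjSum.2 (by simp), by simp [o1Ext]⟩
      · exact ⟨Sum.inr 1, Finset.inr_mem_disjSum.2 (by simp), by simp [o1Ext]⟩
      · exact ⟨Sum.inr 2, Finset.inr_mem_disjSum.2 (by simp), by simp [o1Ext]⟩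
  · refine le_trans (le_of_eq (Finset.card_disjSum _ _)) (le_trans ?_ (le_of_eq (Finset.card_disjSum _ _).symm))
    have e1 : ({1, 2} : Finset (Fin 4)).card = 2 := by decide
    have e2 : ({2, 3} : Finset (Fin 4)).card = 2 := by decide
    omega
  · obtain ⟨s, hs⟩ := hne
    exact ⟨Sum.inl s, Finset.inl_mem_disjSum.2 hs⟩
  · rintro (v | v) hv
    · exact hB v (Finset.inl_mem_disjSum.1 hv)
    · replace hv := Finset.inr_mem_disjSum.1 hv
      fin_cases v <;> simp_all [o1Ext]
  · refine le_trans (le_of_eq (Finset.sum_disjSum _ _ _)) ?_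
    have hm : L.G.edgeSet.ncard + 4 ≤ (o1Ext L y).G.edgeSet.ncard := by
      have := edge_lb (W := L.V ⊕ Fin 4) L.G Function.Embedding.inl
        {s(Sum.inl y, Sum.inr 0), s(Sum.inr 0, Sum.inr 1),
         s(Sum.inr 1, Sum.inr 2), s(Sum.inr 2, Sum.inr 3)} (by
          rintro e (rfl | rfl | rfl | rfl) <;> simp)
      rw [Set.ncard_insert_of_notMem (by simp), Set.ncard_insert_of_notMem (by simp),
        Set.ncard_insert_of_notMem (by simp), Set.ncard_singleton] at this
      exact this
    have hdeg : ∀ u, ((o1Ext L y).G.neighborSet (Sum.inl u)).ncard ≤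
        (L.G.neighborSet u).ncard + if y = u then 1 else 0 := fun u =>
      (o1_deg L.G y u).trans (le_of_eq (by congr))
    have h2 : ((o1Ext L y).G.neighborSet (Sum.inr 2)).ncard ≤ 2 := o1_deg2 L.G y
    have h3 : ((o1Ext L y).G.neighborSet (Sum.inr 3)).ncard ≤ 1 := o1_deg3 L.G y
    have hsumS := Finset.sum_le_sum (fun u (_ : u ∈ S) => hdeg u)
    rw [Finset.sum_add_distrib, Finset.sum_ite_eq] at hsumS
    have hpair : ∑ v ∈ ({2, 3} : Finset (Fin 4)), ((o1Ext L y).G.neighborSet (Sum.inr v)).ncard =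
      ((o1Ext L y).G.neighborSet (Sum.inr 2)).ncard +
        ((o1Ext L y).G.neighborSet (Sum.inr 3)).ncard := Finset.sum_pair (by decide)
    have : (if y ∈ S then 1 else 0) ≤ 1 := by split_ifs <;> simp
    rw [hpair]
    omega

lemma inv_o2 (L : LGraph) (y : L.V) (hy : L.sta y = Status.B) (hL : GInv L) (N : Set (Fin 3))
    (hN : N.Nonempty) :
    Finite (L.V ⊕ Fin 3) ∧ ∃ D S : Finset (o2Ext L y).V,
    (∀ v, ∃ u ∈ D, (o2Ext L y).G.Adj v u) ∧ D.card ≤ S.card ∧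
    S.Nonempty ∧ (∀ s ∈ S, (o2Ext L y).sta s ≠ Status.B) ∧
    ∑ v ∈ S, ((o2Ext L y).G.neighborSet v).ncard ≤ (o2Ext L y).G.edgeSet.ncard + 1 ∧
    ∃ i ∈ N, (Sum.inr i : L.V ⊕ Fin 3) ∈ D := by
  classical
  obtain ⟨hf, D, S, hD, hc, hne, hB, hs⟩ := hL
  have hf' : Finite (L.V ⊕ Fin 3) := inferInstance
  have hf'' : Finite (o2Ext L y).V := hf'
  obtain ⟨P, hPc, ⟨i, hiN, hiP⟩, h1P, hP⟩ : ∃ P : Finset (Fin 3), P.card = 2 ∧ (∃ i ∈ N, i ∈ P) ∧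
      1 ∈ P ∧ (0 ∈ P ∨ 2 ∈ P) := by
    obtain ⟨i, hi⟩ := hN
    fin_cases i
    · exact ⟨{0, 1}, by decide, ⟨_, hi, by decide⟩, by decide, by decide⟩
    · exact ⟨{0, 1}, by decide, ⟨_, hi, by decide⟩, by decide, by decide⟩
    · exact ⟨{1, 2}, by decide, ⟨_, hi, by decide⟩, by decide, by decide⟩
  refine ⟨hf', D.disjSum P, S.disjSum ({1, 2} : Finset (Fin 3)), ?_, ?_, ?_, ?_, ?_, ?_⟩
  · rintro (v | v)
    · obtain ⟨u, hu, hvu⟩ := hD v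
      exact ⟨Sum.inl u, Finset.inl_mem_disjSum.2 hu, by simp [o2Ext, hvu]⟩
    · fin_cases v
      · exact ⟨Sum.inr 1, Finset.inr_mem_disjSum.2 h1P, by simp [o2Ext]⟩
      · rcases hP with h | h
        · exact ⟨Sum.inr 0, Finset.inr_mem_disjSum.2 h, by simp [o2Ext]⟩
        · exact ⟨Sum.inr 2, Finset.inr_mem_disjSum.2 h, by simp [o2Ext]⟩
      · exact ⟨Sum.inr 1, Finset.inr_mem_disjSum.2 h1P, by simp [o2Ext]⟩
  · refine le_trans (le_of_eq (Finset.card_disjSum _ _)) (le_trans ?_ (le_of_eq (Finset.card_disjSum _ _).symm))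
    have e2 : ({1, 2} : Finset (Fin 3)).card = 2 := by decide
    omega
  · obtain ⟨s, hs⟩ := hne
    exact ⟨Sum.inl s, Finset.inl_mem_disjSum.2 hs⟩
  · rintro (v | v) hv
    · exact hB v (Finset.inl_mem_disjSum.1 hv)
    · replace hv := Finset.inr_mem_disjSum.1 hv
      fin_cases v <;> simp_all [o2Ext]
  · refine le_trans (le_of_eq (Finset.sum_disjSum _ _ _)) ?_
    have hm : L.G.edgeSet.ncard + 3 ≤ (o2Ext L y).G.edgeSet.ncard := by
      have := edge_lb (W := L.V ⊕ Fin 3) L.G Function.Embedding.inl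
        {s(Sum.inl y, Sum.inr 0), s(Sum.inr 0, Sum.inr 1),
         s(Sum.inr 1, Sum.inr 2)} (by
          rintro e (rfl | rfl | rfl) <;> simp)
      rw [Set.ncard_insert_of_notMem (by simp), Set.ncard_insert_of_notMem (by simp),
        Set.ncard_singleton] at this
      exact this
    have hdeg : ∀ u ∈ S, ((o2Ext L y).G.neighborSet (Sum.inl u)).ncard ≤
        (L.G.neighborSet u).ncard := fun u hu =>
      o2_deg L.G y u (fun h => hB u hu (h ▸ hy))
    have h2 : ((o2Ext L y).G.neighborSet (Sum.inr 1)).ncard ≤ 2 := o2_deg1 L.G y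
    have h3 : ((o2Ext L y).G.neighborSet (Sum.inr 2)).ncard ≤ 1 := o2_deg2 L.G y
    have hsumS := Finset.sum_le_sum hdeg
    have hpair : ∑ v ∈ ({1, 2} : Finset (Fin 3)), ((o2Ext L y).G.neighborSet (Sum.inr v)).ncard =
      ((o2Ext L y).G.neighborSet (Sum.inr 1)).ncard +
        ((o2Ext L y).G.neighborSet (Sum.inr 2)).ncard := Finset.sum_pair (by decide)
    rw [hpair]
    omega
  · exact ⟨i, hiN, Finset.inr_mem_disjSum.2 hiP⟩

lemma InGamma.inv {L : LGraph} (h : InGamma L) : GInv L := by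
  induction h with
  | base L h => exact inv_base.iso h
  | op1 L y hL hsta hleaf L' h ih => exact (inv_o1 L y ih).iso h
  | op2 L y hL hsta L' h ih =>
    obtain ⟨hf, D, S, h1, h2, h3, h4, h5, _⟩ := inv_o2 L y hsta ih Set.univ Set.univ_nonempty
    have : GInv (o2Ext L y) := ⟨hf, D, S, h1, h2, h3, h4, h5⟩
    exact this.iso h

lemma attach_bound {V : Type} [Finite V] (H : SimpleGraph V) (N : Set V) (D S : Finset V)
    (hD : ∀ v, ∃ u ∈ D, H.Adj v u) (hc : D.card ≤ S.card) (hne : S.Nonempty)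
    (hs : ∑ v ∈ S, (H.neighborSet v).ncard ≤ H.edgeSet.ncard + 1)
    (hN : ∃ i ∈ N, i ∈ D) :
    totalDominationNumber (attachVertex H N) ≤ annihilationNumber (attachVertex H N) + 1 := by
  classical
  have := Fintype.ofFinite V
  have hadj : ∀ u v, H.Adj u v → (attachVertex H N).Adj (Sum.inl u) (Sum.inl v) := by
    intro u v h; simp [attachVertex, h]
  have hγ : totalDominationNumber (attachVertex H N) ≤ D.card := by
    apply Nat.sInf_le
    refine ⟨D.map Function.Embedding.inl, ?_, by simp⟩
    rintro (v | v)
    · obtain ⟨u, hu, hvu⟩ := hD v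
      exact ⟨Sum.inl u, by simpa using hu, hadj _ _ hvu⟩
    · obtain ⟨i, hi, hiD⟩ := hN
      exact ⟨Sum.inl i, by simpa using hiD, by simp [attachVertex, hi]⟩
  have hm : H.edgeSet.ncard + N.ncard ≤ (attachVertex H N).edgeSet.ncard := by
    have := edge_lb (W := V ⊕ Unit) H Function.Embedding.inl
      {e | ∃ u ∈ N, e = s(Sum.inl u, Sum.inr ())} (by
        rintro e ⟨u, hu, rfl⟩; simp)
    refine le_trans (Nat.add_le_add_left ?_ _) this
    rw [← Set.ncard_image_of_injective N
      (f := fun u : V => (s(Sum.inl u, Sum.inr ()) : Sym2 (V ⊕ Unit)))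
      (fun a b h => by simpa using h)]
    apply Set.ncard_le_ncard _ (Set.toFinite _)
    rintro _ ⟨u, hu, rfl⟩
    exact ⟨u, hu, rfl⟩
  have hdeg : ∀ u, ((attachVertex H N).neighborSet (Sum.inl u)).ncard ≤
      (H.neighborSet u).ncard + if u ∈ N then 1 else 0 := by
    intro u
    have hsub : (attachVertex H N).neighborSet (Sum.inl u) ⊆
        (Sum.inl '' H.neighborSet u) ∪ (if u ∈ N then {Sum.inr ()} else ∅ : Set (V ⊕ Unit)) := by
      rintro (a | a) ha
      · left; simpa [attachVertex] using ha
      · right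
        simp [attachVertex] at ha
        simp [ha]
    refine (Set.ncard_le_ncard hsub (Set.toFinite _)).trans
      ((Set.ncard_union_le _ _).trans (Nat.add_le_add (Set.ncard_image_le (Set.toFinite _)) ?_))
    split_ifs <;> simp
  have hsum := Finset.sum_le_sum (fun u (_ : u ∈ S) => hdeg u)
  rw [Finset.sum_add_distrib, Finset.sum_boole] at hsum
  have hSN : (S.filter (· ∈ N)).card ≤ N.ncard := by
    rw [← Set.ncard_coe_finset]
    exact Set.ncard_le_ncard (fun u hu => by simp at hu; exact hu.2) (Set.toFinite _)
  obtain ⟨s, hsS⟩ := hne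
  have hpos : 1 ≤ ((attachVertex H N).neighborSet (Sum.inl s)).ncard := by
    obtain ⟨u, _, hu⟩ := hD s
    exact (Set.ncard_pos (Set.toFinite _)).2 ⟨_, hadj _ _ hu⟩
  have ha : (S.erase s).card ≤ annihilationNumber (attachVertex H N) := by
    apply le_csSup
    · refine ⟨Fintype.card (V ⊕ Unit), ?_⟩
      rintro k ⟨S', rfl, _⟩
      exact Finset.card_le_univ S'
    · refine ⟨(S.erase s).map Function.Embedding.inl, Finset.card_map _, ?_⟩
      rw [Finset.sum_map]
      have := Finset.add_sum_erase S
        (fun u => ((attachVertex H N).neighborSet (Sum.inl u)).ncard) hsS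
      simp only [Nat.cast_id, Function.Embedding.inl_apply] at *
      omega
  rw [Finset.card_erase_of_mem hsS] at ha
  omega

/-- Let `G ∈ QT₆`, i.e. `G` is obtained from a tree `T' = o2Ext T y ∈ Γ₂`
(where `T ∈ Γ`, `y` has status `B`, and `x, w, v` are the vertices added in the last
step) and a new vertex `h` by adding `t₁ ≥ 1` edges between `h` and `{x, w, v}` and
`t₂ ≥ 1` edges between `h` and `V(T') \ {x, w, v}`. If `G' = G[V(G) \ {x, w, v}]`
satisfies `γₜ(G') ≤ a(G') + 1`, then `γₜ(G) ≤ a(G) + 1`. -/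
theorem stmt_6 (T : LGraph) (y : T.V)
    (hT : InGamma T) (hy : T.sta y = Status.B)
    (N₁ : Finset (Fin 3)) (ht₁ : 1 ≤ N₁.card)
    (N₂ : Finset T.V) (ht₂ : 1 ≤ N₂.card)
    (G : SimpleGraph ((T.V ⊕ Fin 3) ⊕ Unit))
    (hG : G = attachVertex (o2Ext T y).G
      (Sum.inr '' (N₁ : Set (Fin 3)) ∪ Sum.inl '' (N₂ : Set T.V)))
    (h' :
      totalDominationNumber (G.induce
        {u | u ∉ ({Sum.inl (Sum.inr 0), Sum.inl (Sum.inr 1),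
          Sum.inl (Sum.inr 2)} : Set ((T.V ⊕ Fin 3) ⊕ Unit))}) ≤
      annihilationNumber (G.induce
        {u | u ∉ ({Sum.inl (Sum.inr 0), Sum.inl (Sum.inr 1),
          Sum.inl (Sum.inr 2)} : Set ((T.V ⊕ Fin 3) ⊕ Unit))}) + 1) :
    totalDominationNumber G ≤ annihilationNumber G + 1 := by
  subst hG
  have hN1 : (N₁ : Set (Fin 3)).Nonempty := by
    simpa using Finset.card_pos.1 ht₁
  obtain ⟨hf, D, S, h1, h2, h3, h4, h5, i, hi, hiD⟩ := inv_o2 T y hy hT.inv (N₁ : Set (Fin 3)) hN1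
  have : Finite (o2Ext T y).V := hf
  exact attach_bound (o2Ext T y).G _ D S h1 h2 h3 h5 ⟨Sum.inr i, Or.inl ⟨i, hi, rfl⟩, hiD⟩
end

section
/- Let G be a connected graph with a cut-vertex v ∈ V(G) and maximum degree Δ(G) ≥ ⌊n(G)/4 + 4⌋. If G − v has a connected component of order n(G) − Δ(G), then γ_t(G) ≤ a(G) + 1. -/
open SimpleGraph

/-- The maximum degree `Δ(G)` of a finite graph. -/
noncomputable def maxDeg {V : Type*} [Fintype V] (G : SimpleGraph V) : ℕ :=
  Finset.univ.sup fun v => (G.neighborSet v).ncard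


/-- weight of a hyperedge of a given size -/
def edgeWt (k : ℕ) : ℕ := if k = 1 then 4 else if k = 2 then 2 else 1

theorem hyper_transversal {V ι : Type*} [DecidableEq V] [DecidableEq ι] (N : ℕ) :
    ∀ (X : Finset V) (E : Finset ι) (f : ι → Finset V),
      X.card + ∑ i ∈ E, (f i).card ≤ N →
      (∀ i ∈ E, f i ⊆ X ∧ (f i).Nonempty) →
      ∃ T : Finset V, (∀ i ∈ E, ∃ x ∈ f i, x ∈ T) ∧
        6 * T.card ≤ 2 * X.card + ∑ i ∈ E, edgeWt (f i).card := by
  induction N with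
  | zero =>
    intro X E f hN hE
    refine ⟨∅, ?_, by simp⟩
    intro i hi
    exfalso
    have h1 : (f i).card ≤ ∑ i ∈ E, (f i).card :=
      Finset.single_le_sum (f := fun i => (f i).card) (fun _ _ => Nat.zero_le _) hi
    have h2 := (hE i hi).2.card_pos
    omega
  | succ N ih =>
    intro X E f hN hE
    have splitS : ∀ (x : V) (g : ι → ℕ), ∑ i ∈ E with x ∈ f i, g i + ∑ i ∈ E with x ∉ f i, g i
        = ∑ i ∈ E, g i := fun x g => Finset.sum_filter_add_sum_filter_not E (fun i => x ∈ f i) g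
    -- the set obtained by picking a vertex
    have pickBase : ∀ x ∈ X, ∃ T : Finset V, (∀ i ∈ E, ∃ y ∈ f i, y ∈ T) ∧
        6 * T.card + ∑ i ∈ E with x ∈ f i, edgeWt (f i).card
          ≤ 4 + 2 * X.card + ∑ i ∈ E, edgeWt (f i).card := by
      intro x hx
      have hc := Finset.card_erase_add_one hx
      have hs := splitS x (fun i => (f i).card)
      have hw := splitS x (fun i => edgeWt (f i).card)
      obtain ⟨T, hT, hTc⟩ := ih (X.erase x) (E.filter (fun i => x ∉ f i)) f (by omega) (by
        intro i hi
        rw [Finset.mem_filter] at hi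
        exact ⟨Finset.subset_erase.2 ⟨(hE i hi.1).1, hi.2⟩, (hE i hi.1).2⟩)
      refine ⟨insert x T, ?_, ?_⟩
      · intro i hi
        by_cases hxi : x ∈ f i
        · exact ⟨x, hxi, Finset.mem_insert_self _ _⟩
        · obtain ⟨y, hy, hyT⟩ := hT i (Finset.mem_filter.2 ⟨hi, hxi⟩)
          exact ⟨y, hy, Finset.mem_insert_of_mem hyT⟩
      · have := Finset.card_insert_le x T
        omega
    by_cases h1 : ∃ x ∈ X, 4 ≤ ∑ i ∈ E with x ∈ f i, edgeWt (f i).card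
    · obtain ⟨x, hx, h4⟩ := h1
      obtain ⟨T, hT, hTc⟩ := pickBase x hx
      exact ⟨T, hT, by omega⟩
    push Not at h1
    have hwle : ∀ i ∈ E, ∀ x ∈ f i, edgeWt (f i).card ≤ ∑ i ∈ E with x ∈ f i, edgeWt (f i).card := by
      intro i hi x hx
      exact Finset.single_le_sum (f := fun i => edgeWt (f i).card) (fun _ _ => Nat.zero_le _)
        (Finset.mem_filter.2 ⟨hi, hx⟩)
    have hsz2 : ∀ i ∈ E, 2 ≤ (f i).card := by
      intro i hi
      by_contra hlt
      have h2 := (hE i hi).2.card_pos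
      have h3 : (f i).card = 1 := by omega
      obtain ⟨x, hx⟩ := (hE i hi).2
      have h4 := hwle i hi x hx
      have h5 := h1 x ((hE i hi).1 hx)
      rw [h3] at h4
      simp only [edgeWt] at h4 h5
      simp at h4
      omega
    by_cases h2 : ∃ i ∈ E, 4 ≤ (f i).card
    · obtain ⟨i, hi, hi4⟩ := h2
      obtain ⟨a, ha⟩ := (hE i hi).2
      have hca := Finset.card_erase_add_one ha
      have hs1 := Finset.sum_erase_add E (fun j => (f j).card) hi
      have hs2 := Finset.sum_erase_add E
        (fun j => (Function.update f i ((f i).erase a) j).card) hi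
      have hw1 := Finset.sum_erase_add E (fun j => edgeWt (f j).card) hi
      have hw2 := Finset.sum_erase_add E
        (fun j => edgeWt (Function.update f i ((f i).erase a) j).card) hi
      have e1 : ∑ j ∈ E.erase i, (Function.update f i ((f i).erase a) j).card
          = ∑ j ∈ E.erase i, (f j).card := Finset.sum_congr rfl (by
        intro j hj
        rw [Function.update_of_ne (Finset.ne_of_mem_erase hj)])
      have e2 : ∑ j ∈ E.erase i, edgeWt (Function.update f i ((f i).erase a) j).card
          = ∑ j ∈ E.erase i, edgeWt (f j).card := Finset.sum_congr rfl (by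
        intro j hj
        rw [Function.update_of_ne (Finset.ne_of_mem_erase hj)])
      rw [e1] at hs2
      rw [e2] at hw2
      simp only [Function.update_self] at hs2 hw2
      have w1 : edgeWt (f i).card = 1 := by
        unfold edgeWt; split_ifs <;> omega
      have w2 : edgeWt ((f i).erase a).card = 1 := by
        unfold edgeWt; split_ifs <;> omega
      obtain ⟨T, hT, hTc⟩ := ih X E (Function.update f i ((f i).erase a)) (by omega) (by
        intro j hj
        by_cases hji : j = i
        · subst hji
          rw [Function.update_self]
          exact ⟨(Finset.erase_subset _ _).trans (hE j hj).1, Finset.card_pos.1 (by omega)⟩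
        · rw [Function.update_of_ne hji]
          exact hE j hj)
      refine ⟨T, ?_, by omega⟩
      intro j hj
      obtain ⟨y, hy, hyT⟩ := hT j hj
      refine ⟨y, ?_, hyT⟩
      by_cases hji : j = i
      · subst hji
        rw [Function.update_self] at hy
        exact Finset.mem_of_mem_erase hy
      · rwa [Function.update_of_ne hji] at hy
    push Not at h2
    -- cost of deleting a vertex
    have delCost : ∀ (x : V) (E' : Finset ι), E' ⊆ E →
        ∑ i ∈ E', edgeWt ((f i).erase x).card
          = ∑ i ∈ E', edgeWt (f i).card + ∑ i ∈ E' with x ∈ f i, edgeWt (f i).card := by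
      intro x E' hE'
      rw [Finset.sum_filter, ← Finset.sum_add_distrib]
      refine Finset.sum_congr rfl ?_
      intro i hi
      have a1 := hsz2 i (hE' hi)
      have a2 := h2 i (hE' hi)
      by_cases hx : x ∈ f i
      · have a3 := Finset.card_erase_add_one hx
        have : (f i).card = 2 ∨ (f i).card = 3 := by omega
        rcases this with h | h
        · have : ((f i).erase x).card = 1 := by omega
          simp [edgeWt, hx, h, this]
        · have : ((f i).erase x).card = 2 := by omega
          simp [edgeWt, hx, h, this]
      · simp [hx]
    have delNe : ∀ (x : V), ∀ i ∈ E, (f i).erase x ⊆ X.erase x ∧ ((f i).erase x).Nonempty := by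
      intro x i hi
      refine ⟨Finset.erase_subset_erase _ (hE i hi).1, Finset.card_pos.1 ?_⟩
      have := Finset.pred_card_le_card_erase (s := f i) (a := x)
      have := hsz2 i hi
      omega
    have delSum : ∀ (x : V) (E' : Finset ι), E' ⊆ E →
        ∑ i ∈ E', ((f i).erase x).card ≤ ∑ i ∈ E, (f i).card := by
      intro x E' hE'
      calc _ ≤ ∑ i ∈ E', (f i).card := Finset.sum_le_sum (fun i _ => Finset.card_erase_le)
        _ ≤ _ := Finset.sum_le_sum_of_subset hE'
    by_cases h3 : ∃ x ∈ X, ∑ i ∈ E with x ∈ f i, edgeWt (f i).card ≤ 2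
    · obtain ⟨x, hx, hx2⟩ := h3
      have hc := Finset.card_erase_add_one hx
      have hs := delSum x E (Finset.Subset.refl _)
      have hw := delCost x E (Finset.Subset.refl _)
      obtain ⟨T, hT, hTc⟩ := ih (X.erase x) E (fun i => (f i).erase x) (by omega) (delNe x)
      refine ⟨T, ?_, by omega⟩
      intro i hi
      obtain ⟨y, hy, hyT⟩ := hT i hi
      exact ⟨y, Finset.mem_of_mem_erase hy, hyT⟩
    push Not at h3
    have hW : ∀ x ∈ X, ∑ i ∈ E with x ∈ f i, edgeWt (f i).card = 3 := by
      intro x hx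
      have := h1 x hx
      have := h3 x hx
      omega
    by_cases h4 : ∃ i ∈ E, (f i).card = 2
    · obtain ⟨i, hi, hi2⟩ := h4
      obtain ⟨x, y, hxy, hfi⟩ := Finset.card_eq_two.1 hi2
      have hxi : x ∈ f i := by rw [hfi]; simp
      have hyi : y ∈ f i := by rw [hfi]; simp
      have hxX := (hE i hi).1 hxi
      have hyX := (hE i hi).1 hyi
      have hyX' : y ∈ X.erase x := Finset.mem_erase.2 ⟨hxy.symm, hyX⟩
      set E' := E.filter (fun i => x ∉ f i) with hE'
      have hsub : E' ⊆ E := Finset.filter_subset _ _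
      have hc1 := Finset.card_erase_add_one hxX
      have hc2 := Finset.card_erase_add_one hyX'
      have hs := delSum y E' hsub
      have hw := delCost y E' hsub
      have hw2 : ∑ i ∈ E with x ∈ f i, edgeWt (f i).card + ∑ i ∈ E', edgeWt (f i).card
          = ∑ i ∈ E, edgeWt (f i).card := splitS x (fun i => edgeWt (f i).card)
      have hw3 := hW x hxX
      have hw4 : ∑ j ∈ E' with y ∈ f j, edgeWt (f j).card ≤ 1 := by
        have h := hW y hyX
        have hmem : i ∈ E.filter (fun j => y ∈ f j) := Finset.mem_filter.2 ⟨hi, hyi⟩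
        have hh := Finset.sum_erase_add _ (fun j => edgeWt (f j).card) hmem
        have hsub2 : E'.filter (fun j => y ∈ f j) ⊆ (E.filter (fun j => y ∈ f j)).erase i := by
          intro j hj
          simp only [hE', Finset.mem_filter, Finset.mem_erase] at hj ⊢
          refine ⟨?_, hj.1.1, hj.2⟩
          rintro rfl
          exact hj.1.2 hxi
        have hle := Finset.sum_le_sum_of_subset (f := fun j => edgeWt (f j).card) hsub2
        have w2 : edgeWt (f i).card = 2 := by rw [hi2]; rfl
        omega
      obtain ⟨T, hT, hTc⟩ := ih ((X.erase x).erase y) E' (fun i => (f i).erase y) (by omega) (by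
        intro j hj
        refine ⟨?_, (delNe y j (hsub hj)).2⟩
        refine Finset.erase_subset_erase _ (Finset.subset_erase.2 ⟨(hE j (hsub hj)).1, ?_⟩)
        exact (Finset.mem_filter.1 hj).2)
      refine ⟨insert x T, ?_, ?_⟩
      · intro j hj
        by_cases hxj : x ∈ f j
        · exact ⟨x, hxj, Finset.mem_insert_self _ _⟩
        · obtain ⟨z, hz, hzT⟩ := hT j (Finset.mem_filter.2 ⟨hj, hxj⟩)
          exact ⟨z, Finset.mem_of_mem_erase hz, Finset.mem_insert_of_mem hzT⟩
      · have := Finset.card_insert_le x T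
        omega
    push Not at h4
    have h33 : ∀ i ∈ E, (f i).card = 3 := by
      intro i hi
      have := h2 i hi
      have := hsz2 i hi
      have := h4 i hi
      omega
    have hw1 : ∀ i ∈ E, edgeWt (f i).card = 1 := by
      intro i hi
      rw [h33 i hi]; rfl
    have hEc : ∑ i ∈ E, edgeWt (f i).card = E.card := by
      rw [Finset.sum_congr rfl hw1]; simp
    have hdc : 3 * X.card = 3 * E.card := by
      have e1 : ∑ x ∈ X, ∑ i ∈ E with x ∈ f i, edgeWt (f i).card = ∑ x ∈ X, 3 :=
        Finset.sum_congr rfl hW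
      have e2 : ∑ x ∈ X, ∑ i ∈ E with x ∈ f i, edgeWt (f i).card
          = ∑ i ∈ E, ∑ x ∈ X with x ∈ f i, edgeWt (f i).card := by
        simp only [Finset.sum_filter]
        exact Finset.sum_comm
      have e3 : ∑ i ∈ E, ∑ x ∈ X with x ∈ f i, edgeWt (f i).card = ∑ i ∈ E, 3 := by
        refine Finset.sum_congr rfl ?_
        intro i hi
        have : X.filter (fun x => x ∈ f i) = f i := by
          ext x
          simp only [Finset.mem_filter]
          exact ⟨fun h => h.2, fun h => ⟨(hE i hi).1 h, h⟩⟩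
        rw [this, Finset.sum_const, hw1 i hi, h33 i hi]
        rfl
      rw [e2, e3] at e1
      simp at e1
      omega
    by_cases hX : X.Nonempty
    · obtain ⟨x, hx⟩ := hX
      obtain ⟨T, hT, hTc⟩ := pickBase x hx
      refine ⟨T, hT, ?_⟩
      have := hW x hx
      omega
    · rw [Finset.not_nonempty_iff_eq_empty] at hX
      refine ⟨∅, ?_, by simp⟩
      intro i hi
      obtain ⟨x, hx⟩ := (hE i hi).2
      have := (hE i hi).1 hx
      simp [hX] at this

/-- A level function of a spanning tree rooted at `r`. -/
def IsLevel {V : Type*} (G : SimpleGraph V) (r : V) (l : V → ℕ) : Prop :=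
  l r = 0 ∧ ∀ x, x ≠ r → ∃ y, G.Adj x y ∧ l y + 1 = l x

theorem IsLevel.lt_card {V : Type*} [Fintype V] {G : SimpleGraph V} {r : V} {l : V → ℕ}
    (h : IsLevel G r l) (x : V) : l x < Fintype.card V := by
  classical
  have key : ∀ k, ∀ x, l x = k → ∀ j ≤ k, ∃ y, l y = j := by
    intro k
    induction k with
    | zero => intro x hx j hj; exact ⟨x, by omega⟩
    | succ k ih =>
      intro x hx j hj
      by_cases hjk : j = k + 1
      · exact ⟨x, by omega⟩
      · have hxr : x ≠ r := by
          rintro rfl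
          have := h.1
          omega
        obtain ⟨y, -, hy⟩ := h.2 x hxr
        exact ih y (by omega) j (by omega)
  have hsub : Finset.range (l x + 1) ⊆ Finset.univ.image l := by
    intro j hj
    rw [Finset.mem_range] at hj
    obtain ⟨y, hy⟩ := key (l x) x rfl j (by omega)
    exact Finset.mem_image.2 ⟨y, Finset.mem_univ _, hy⟩
  have h1 := Finset.card_le_card hsub
  have h2 : (Finset.univ.image l).card ≤ Fintype.card V := Finset.card_image_le
  rw [Finset.card_range] at h1
  omega

theorem exists_isLevel {V : Type*} {G : SimpleGraph V} (hG : G.Connected) (r : V) :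
    ∃ l, IsLevel G r l := by
  refine ⟨fun x => G.dist x r, by simp, ?_⟩
  intro x hx
  obtain ⟨p, hp⟩ := hG.exists_walk_length_eq_dist x r
  cases p with
  | nil => exact absurd rfl hx
  | cons h q =>
    rename_i y
    refine ⟨y, h, ?_⟩
    have h1 := SimpleGraph.dist_le q
    have h2 := hG.dist_triangle (u := x) (v := y) (w := r)
    have h3 : G.dist x y = 1 := SimpleGraph.dist_eq_one_iff_adj.2 h
    rw [Walk.length_cons] at hp
    show G.dist y r + 1 = G.dist x r
    omega

theorem exists_max_level {V : Type*} [Fintype V] {G : SimpleGraph V} (hG : G.Connected) (r : V) :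
    ∃ l, IsLevel G r l ∧ ∀ l', IsLevel G r l' → ∑ x, l' x ≤ ∑ x, l x := by
  have hbdd : BddAbove {s | ∃ l, IsLevel G r l ∧ ∑ x, l x = s} := by
    refine ⟨∑ _x : V, Fintype.card V, ?_⟩
    rintro s ⟨l, hl, rfl⟩
    exact Finset.sum_le_sum (fun x _ => (hl.lt_card x).le)
  have hne : {s | ∃ l, IsLevel G r l ∧ ∑ x, l x = s}.Nonempty := by
    obtain ⟨l, hl⟩ := exists_isLevel hG r
    exact ⟨_, l, hl, rfl⟩
  obtain ⟨l, hl, hs⟩ := Nat.sSup_mem hne hbdd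
  refine ⟨l, hl, fun l' hl' => ?_⟩
  rw [hs]
  exact le_csSup hbdd ⟨l', hl', rfl⟩

/-- Levels that are congruent to `i` or `i + 1` modulo four. -/
def LevSel (i t : ℕ) : Prop := t % 4 = i ∨ t % 4 = (i + 1) % 4

instance (i t : ℕ) : Decidable (LevSel i t) := by unfold LevSel; infer_instance

theorem sum_levSel (t : ℕ) : ∑ i ∈ Finset.range 4, (if LevSel i t then 1 else 0) = 2 := by
  have h : t % 4 = 0 ∨ t % 4 = 1 ∨ t % 4 = 2 ∨ t % 4 = 3 := by omega
  rcases h with h | h | h | h <;> simp only [LevSel, h] <;> decide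

theorem sum_not_levSel (t : ℕ) : ∑ i ∈ Finset.range 4, (if ¬ LevSel i t then 1 else 0) = 2 := by
  have h : t % 4 = 0 ∨ t % 4 = 1 ∨ t % 4 = 2 ∨ t % 4 = 3 := by omega
  rcases h with h | h | h | h <;> simp only [LevSel, h] <;> decide

theorem level_bound {V : Type*} [Fintype V] [DecidableEq V] (G : SimpleGraph V)
    [DecidableRel G.Adj] (hG : G.Connected) (hn : 2 ≤ Fintype.card V) :
    ∃ D : Finset V, (∀ v, ∃ u ∈ D, G.Adj v u) ∧
      2 * D.card ≤ G.edgeFinset.card + (Finset.univ.filter (fun x => G.degree x = 1)).card + 2 := by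
  obtain ⟨r⟩ := hG.nonempty
  obtain ⟨l, hl, hmax⟩ := exists_max_level hG r
  -- the root has a child
  have hr : ∃ c, G.Adj r c ∧ l c = 1 := by
    have : Nontrivial V := Fintype.one_lt_card_iff_nontrivial.1 hn
    obtain ⟨x, hx⟩ := exists_ne r
    have key : ∀ k, ∀ x, x ≠ r → l x = k → ∃ c, G.Adj r c ∧ l c = 1 := by
      intro k
      induction k with
      | zero =>
        intro x hx hk
        obtain ⟨y, -, hy⟩ := hl.2 x hx
        omega
      | succ k ih =>
        intro x hx hk
        obtain ⟨y, hxy, hy⟩ := hl.2 x hx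
        by_cases hyr : y = r
        · subst hyr
          exact ⟨x, hxy.symm, by have := hl.1; omega⟩
        · exact ih y hyr (by omega)
    exact key _ x hx rfl
  obtain ⟨c, hrc, hc⟩ := hr
  have hpar : ∀ x, ∃ y, x ≠ r → G.Adj x y ∧ l y + 1 = l x := by
    intro x
    by_cases hx : x = r
    · exact ⟨x, fun h => absurd hx h⟩
    · obtain ⟨y, hy⟩ := hl.2 x hx
      exact ⟨y, fun _ => hy⟩
  choose p hp using hpar
  -- the set of vertices without a child
  set K : Finset V := Finset.univ.filter (fun x => ∀ y, G.Adj x y → l y ≠ l x + 1) with hK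
  have hmemK : ∀ x, x ∈ K ↔ ∀ y, G.Adj x y → l y ≠ l x + 1 := by
    intro x; simp [hK]
  have hrK : r ∉ K := by
    rw [hmemK]
    intro h
    exact h c hrc (by rw [hc, hl.1])
  have hindep' : ∀ x ∈ K, ∀ y ∈ K, G.Adj x y → l y < l x := by
    intro x hx y hy hxy
    by_contra hle
    push Not at hle
    have hxr : x ≠ r := fun h => hrK (h ▸ hx)
    have hl' : IsLevel G r (Function.update l x (l y + 1)) := by
      constructor
      · rw [Function.update_of_ne hxr.symm]; exact hl.1
      · intro z hz
        by_cases hzx : z = x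
        · subst hzx
          refine ⟨y, hxy, ?_⟩
          rw [Function.update_self, Function.update_of_ne hxy.ne']
        · obtain ⟨h1, h2⟩ := hp z hz
          refine ⟨p z, h1, ?_⟩
          rw [Function.update_of_ne hzx]
          by_cases hpx : p z = x
          · exfalso
            rw [hpx] at h1 h2
            exact (hmemK x).1 hx z h1.symm h2.symm
          · rw [Function.update_of_ne hpx, h2]
    have h1 := hmax _ hl'
    have h2 : ∑ z, l z < ∑ z, Function.update l x (l y + 1) z := by
      refine Finset.sum_lt_sum ?_ ⟨x, Finset.mem_univ _, ?_⟩
      · intro z _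
        by_cases hzx : z = x
        · subst hzx
          rw [Function.update_self]; omega
        · rw [Function.update_of_ne hzx]
      · rw [Function.update_self]; omega
    omega
  have hindep : ∀ x ∈ K, ∀ y ∈ K, ¬ G.Adj x y := by
    intro x hx y hy hxy
    have h1 := hindep' x hx y hy hxy
    have h2 := hindep' y hy x hx hxy.symm
    omega
  -- counting edges
  have hnl : ∀ x, ∃ y, x ∈ K → G.degree x ≠ 1 → G.Adj x y ∧ y ≠ p x := by
    intro x
    by_cases hx : x ∈ K ∧ G.degree x ≠ 1
    · have hxr : x ≠ r := fun h => hrK (h ▸ hx.1)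
      have h1 : p x ∈ G.neighborFinset x := by
        rw [mem_neighborFinset]; exact (hp x hxr).1
      have h2 : 1 < (G.neighborFinset x).card := by
        have := Finset.card_pos.2 ⟨_, h1⟩
        rw [card_neighborFinset_eq_degree] at this ⊢
        have := hx.2
        omega
      obtain ⟨y, hy, hyp⟩ := Finset.exists_mem_ne h2 (p x)
      exact ⟨y, fun _ _ => ⟨by simpa using hy, hyp⟩⟩
    · exact ⟨x, fun h1 h2 => absurd ⟨h1, h2⟩ hx⟩
  choose q hq using hnl
  set A := (Finset.univ.erase r).image (fun x => s(x, p x)) with hA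
  set K' := K.filter (fun x => G.degree x ≠ 1) with hK'
  set B := K'.image (fun x => s(x, q x)) with hB
  have hAc : A.card = Fintype.card V - 1 := by
    rw [hA, Finset.card_image_of_injOn, Finset.card_erase_of_mem (Finset.mem_univ _),
      Finset.card_univ]
    intro x hx y hy hxy
    simp only [Finset.coe_erase, Finset.coe_univ, Set.mem_sdiff, Set.mem_univ, true_and,
      Set.mem_singleton_iff] at hx hy
    have h1 := (hp x hx).2
    have h2 := (hp y hy).2
    simp only [Sym2.eq_iff] at hxy
    rcases hxy with h | h
    · exact h.1
    · rw [h.2] at h1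
      rw [← h.1] at h2
      omega
  have hBc : B.card = K'.card := by
    rw [hB, Finset.card_image_of_injOn]
    intro x hx y hy hxy
    simp only [hK', Finset.coe_filter, Set.mem_ofPred_eq] at hx hy
    simp only [Sym2.eq_iff] at hxy
    rcases hxy with h | h
    · exact h.1
    · exfalso
      have := (hq x hx.1 hx.2).1
      rw [h.2] at this
      exact hindep x hx.1 y hy.1 this
  have hdisj : Disjoint A B := by
    rw [Finset.disjoint_left]
    intro e heA heB
    simp only [hA, hB, hK', Finset.mem_image, Finset.mem_filter, Finset.mem_erase] at heA heB
    obtain ⟨z, ⟨hz, -⟩, rfl⟩ := heA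
    obtain ⟨x, hx, hxe⟩ := heB
    rw [Sym2.eq_iff] at hxe
    have h1 := hp z hz
    have h2 := hq x hx.1 hx.2
    rcases hxe with h | h
    · obtain ⟨h3, h4⟩ := h
      rw [h3] at h2 h4
      exact h2.2 h4
    · rw [← h.1] at h1
      exact (hmemK x).1 hx.1 z h1.1.symm h1.2.symm
  have hsub : A ∪ B ⊆ G.edgeFinset := by
    intro e he
    rw [mem_edgeFinset]
    rw [Finset.mem_union] at he
    rcases he with he | he
    · simp only [hA, Finset.mem_image, Finset.mem_erase] at he
      obtain ⟨z, ⟨hz, -⟩, rfl⟩ := he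
      exact (hp z hz).1
    · simp only [hB, hK', Finset.mem_image, Finset.mem_filter] at he
      obtain ⟨z, hz, rfl⟩ := he
      exact (hq z hz.1 hz.2).1
  have hm : Fintype.card V - 1 + K'.card ≤ G.edgeFinset.card := by
    rw [← hAc, ← hBc, ← Finset.card_union_of_disjoint hdisj]
    exact Finset.card_le_card hsub
  have hKc : K.card ≤ (Finset.univ.filter (fun x => G.degree x = 1)).card + K'.card := by
    have h1 := Finset.card_filter_add_card_filter_not (s := K) (fun x => G.degree x = 1)
    have h2 : (K.filter (fun x => G.degree x = 1)).card
        ≤ (Finset.univ.filter (fun x => G.degree x = 1)).card :=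
      Finset.card_le_card (Finset.filter_subset_filter _ (Finset.subset_univ _))
    have h3 : K'.card = (K.filter (fun x => ¬ G.degree x = 1)).card := rfl
    omega
  -- the four candidate sets
  let D : ℕ → Finset V := fun i =>
    (Finset.univ.filter (fun x => LevSel i (l x))) ∪
    ((K.filter (fun x => ¬ LevSel i (l x + 3))).image p) ∪
    (if ¬ LevSel i 1 then {c} else ∅)
  have hD : ∀ i < 4, ∀ v, ∃ u ∈ D i, G.Adj v u := by
    intro i hi v
    by_cases hvr : v = r
    · subst hvr
      refine ⟨c, ?_, hrc⟩
      by_cases h1 : LevSel i 1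
      · simp only [D, Finset.mem_union, Finset.mem_filter]
        left; left
        exact ⟨Finset.mem_univ _, by rwa [hc]⟩
      · simp only [D, Finset.mem_union]
        right
        simp [h1]
    · obtain ⟨h1, h2⟩ := hp v hvr
      by_cases h3 : LevSel i (l v + 3)
      · refine ⟨p v, ?_, h1⟩
        simp only [D, Finset.mem_union, Finset.mem_filter]
        left; left
        refine ⟨Finset.mem_univ _, ?_⟩
        unfold LevSel at h3 ⊢
        omega
      · by_cases hvK : v ∈ K
        · refine ⟨p v, ?_, h1⟩
          simp only [D, Finset.mem_union]
          left; right
          exact Finset.mem_image.2 ⟨v, Finset.mem_filter.2 ⟨hvK, h3⟩, rfl⟩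
        · rw [hmemK] at hvK
          push Not at hvK
          obtain ⟨y, hy, hly⟩ := hvK
          refine ⟨y, ?_, hy⟩
          simp only [D, Finset.mem_union, Finset.mem_filter]
          left; left
          refine ⟨Finset.mem_univ _, ?_⟩
          unfold LevSel at h3 ⊢
          omega
  have hDc : ∀ i, (D i).card ≤ ∑ x : V, (if LevSel i (l x) then 1 else 0) +
      ∑ x ∈ K, (if ¬ LevSel i (l x + 3) then 1 else 0) + (if ¬ LevSel i 1 then 1 else 0) := by
    intro i
    simp only [D]
    refine (Finset.card_union_le _ _).trans (add_le_add ((Finset.card_union_le _ _).trans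
      (add_le_add ?_ ?_)) ?_)
    · rw [Finset.card_filter]
    · refine Finset.card_image_le.trans ?_
      rw [Finset.card_filter]
    · split_ifs <;> simp
  have hsum : ∑ i ∈ Finset.range 4, (D i).card ≤ 2 * Fintype.card V + 2 * K.card + 2 := by
    refine (Finset.sum_le_sum (fun i _ => hDc i)).trans ?_
    rw [Finset.sum_add_distrib, Finset.sum_add_distrib, Finset.sum_comm,
      Finset.sum_comm (t := K), sum_not_levSel]
    simp only [sum_levSel, sum_not_levSel, Finset.sum_const, Finset.card_univ, smul_eq_mul]
    omega
  have hex : ∃ i < 4, 4 * (D i).card ≤ 2 * Fintype.card V + 2 * K.card + 2 := by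
    by_contra hcon
    push Not at hcon
    have h0 := hcon 0 (by norm_num)
    have h1 := hcon 1 (by norm_num)
    have h2 := hcon 2 (by norm_num)
    have h3 := hcon 3 (by norm_num)
    simp only [Finset.sum_range_succ, Finset.sum_range_zero] at hsum
    omega
  obtain ⟨i, hi, hic⟩ := hex
  exact ⟨D i, hD i hi, by omega⟩

/-- payment of a vertex of given degree -/
def vtxPay (d : ℕ) : ℕ := if d = 1 then 5 else if d = 2 then 4 else 3

theorem deg_bound {V : Type*} [Fintype V] [DecidableEq V] (G : SimpleGraph V)
    [DecidableRel G.Adj] (hnl : ∀ x, ∃ y, G.Adj x y ∧ G.degree y ≠ 1) :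
    ∃ D : Finset V, (∀ v, ∃ u ∈ D, G.Adj v u) ∧ 6 * D.card ≤ ∑ x, vtxPay (G.degree x) := by
  classical
  have hleaf : ∀ x y z, G.degree x = 1 → G.Adj x y → G.Adj x z → y = z := by
    intro x y z hx hy hz
    rw [← card_neighborFinset_eq_degree] at hx
    exact Finset.card_le_one.1 hx.le y (by simpa using hy) z (by simpa using hz)
  set L : Finset V := Finset.univ.filter (fun x => G.degree x = 1) with hL
  set S : Finset V := Finset.univ.filter (fun x => ∃ y, G.Adj x y ∧ G.degree y = 1) with hS
  set U : Finset V := Finset.univ.filter (fun x => ∃ y ∈ S, G.Adj x y) with hU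
  set M : Finset V := Finset.univ.filter (fun x => x ∉ L ∧ x ∉ S) with hM
  let g : V → Finset V := fun x => (G.neighborFinset x).filter (fun y => G.degree y ≠ 1)
  let lf : V → Finset V := fun x => (G.neighborFinset x).filter (fun y => G.degree y = 1)
  have memL : ∀ x, x ∈ L ↔ G.degree x = 1 := by intro x; simp [hL]
  have memS : ∀ x, x ∈ S ↔ ∃ y, G.Adj x y ∧ G.degree y = 1 := by intro x; simp [hS]
  have memU : ∀ x, x ∈ U ↔ ∃ y ∈ S, G.Adj x y := by intro x; simp [hU]
  have memM : ∀ x, x ∈ M ↔ x ∉ L ∧ x ∉ S := by intro x; simp [hM]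
  have memg : ∀ x y, y ∈ g x ↔ G.Adj x y ∧ G.degree y ≠ 1 := by intro x y; simp [g]
  have hdeg : ∀ x, (lf x).card + (g x).card = G.degree x := by
    intro x
    rw [← card_neighborFinset_eq_degree]
    exact Finset.card_filter_add_card_filter_not (s := G.neighborFinset x)
      (fun y => G.degree y = 1)
  have hgpos : ∀ x, 0 < (g x).card := by
    intro x
    obtain ⟨y, hy⟩ := hnl x
    exact Finset.card_pos.2 ⟨y, (memg x y).2 hy⟩
  have hlfpos : ∀ x, x ∈ S ↔ 0 < (lf x).card := by
    intro x
    rw [memS, Finset.card_pos]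
    constructor
    · rintro ⟨y, h1, h2⟩
      exact ⟨y, by simp [lf, h1, h2]⟩
    · rintro ⟨y, hy⟩
      simp only [lf, Finset.mem_filter, mem_neighborFinset] at hy
      exact ⟨y, hy⟩
  have hLS : ∀ x, x ∈ L → x ∉ S := by
    intro x hx hxS
    have h1 := (hlfpos x).1 hxS
    have h2 := hgpos x
    have h3 := hdeg x
    have h4 := (memL x).1 hx
    omega
  have hLU : ∀ x, x ∈ L → x ∈ U := by
    intro x hx
    obtain ⟨y, hy, -⟩ := hnl x
    exact (memU x).2 ⟨y, (memS y).2 ⟨x, hy.symm, (memL x).1 hx⟩, hy⟩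
  set B : Finset V := S.filter (fun x => x ∉ U ∧ (g x).card = 1) with hB
  set Y : Finset V := B.biUnion g with hY
  set E : Finset V := Finset.univ.filter (fun x => x ∉ U ∧ Disjoint (g x) Y) with hE
  have memB : ∀ x, x ∈ B ↔ x ∈ S ∧ x ∉ U ∧ (g x).card = 1 := by intro x; simp [hB]
  have memE : ∀ x, x ∈ E ↔ x ∉ U ∧ Disjoint (g x) Y := by intro x; simp [hE]
  have hYB : Y.card ≤ B.card := by
    refine Finset.card_biUnion_le.trans ?_
    rw [Finset.sum_congr rfl (fun x hx => ((memB x).1 hx).2.2)]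
    simp
  have hgM : ∀ x, x ∉ U → g x ⊆ M := by
    intro x hx y hy
    rw [memg] at hy
    rw [memM, memL]
    refine ⟨hy.2, fun hyS => hx ((memU x).2 ⟨y, hyS, hy.1⟩)⟩
  have hYM : Y ⊆ M := by
    intro y hy
    obtain ⟨x, hx, hxy⟩ := Finset.mem_biUnion.1 hy
    exact hgM x ((memB x).1 hx).2.1 hxy
  have hYU : Y ⊆ U := by
    intro y hy
    obtain ⟨x, hx, hxy⟩ := Finset.mem_biUnion.1 hy
    exact (memU y).2 ⟨x, ((memB x).1 hx).1, ((memg x y).1 hxy).1.symm⟩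
  have hEB : ∀ x, x ∈ E → x ∉ B := by
    intro x hx hxB
    obtain ⟨y, hy⟩ := Finset.card_pos.1 (hgpos x)
    exact Finset.disjoint_left.1 ((memE x).1 hx).2 hy (Finset.mem_biUnion.2 ⟨x, hxB, hy⟩)
  obtain ⟨T, hT, hTc⟩ := hyper_transversal _ (M \ Y) E g le_rfl (by
    intro x hx
    refine ⟨?_, Finset.card_pos.1 (hgpos x)⟩
    intro y hy
    exact Finset.mem_sdiff.2 ⟨hgM x ((memE x).1 hx).1 hy,
      Finset.disjoint_left.1 ((memE x).1 hx).2 hy⟩)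
  refine ⟨S ∪ Y ∪ T, ?_, ?_⟩
  · intro v
    by_cases hvU : v ∈ U
    · obtain ⟨y, hyS, hy⟩ := (memU v).1 hvU
      exact ⟨y, by simp [hyS], hy⟩
    · by_cases hvE : v ∈ E
      · obtain ⟨y, hy, hyT⟩ := hT v hvE
        exact ⟨y, by simp [hyT], ((memg v y).1 hy).1⟩
      · have : ¬ Disjoint (g v) Y := fun h => hvE ((memE v).2 ⟨hvU, h⟩)
        obtain ⟨y, hy, hyY⟩ := Finset.not_disjoint_iff.1 this
        exact ⟨y, by simp [hyY], ((memg v y).1 hy).1⟩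
  · have hpt : ∀ x, 6 * (if x ∈ S then 1 else 0) + 3 * (if x ∈ B then 1 else 0)
        + (if x ∈ E then edgeWt (g x).card else 0) + 2 * (if x ∈ M then 1 else 0)
        + (if x ∈ Y then 1 else 0) + 5 * (if x ∈ L then 1 else 0)
        ≤ vtxPay (G.degree x) + 5 * (lf x).card := by
      intro x
      have hd := hdeg x
      have hg := hgpos x
      have hwle : ∀ k, 2 ≤ k → edgeWt k ≤ 2 := by
        intro k hk; unfold edgeWt; split_ifs <;> omega
      have hpge : 3 ≤ vtxPay (G.degree x) := by unfold vtxPay; split_ifs <;> omega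
      by_cases hxL : x ∈ L
      · have h1 := hLS x hxL
        have h2 : x ∉ B := fun h => h1 ((memB x).1 h).1
        have h3 : x ∉ E := fun h => ((memE x).1 h).1 (hLU x hxL)
        have h4 : x ∉ M := fun h => ((memM x).1 h).1 hxL
        have h5 : x ∉ Y := fun h => h4 (hYM h)
        have h6 := (memL x).1 hxL
        simp only [hxL, h1, h2, h3, h4, h5, if_true, if_false, h6, vtxPay]
        omega
      · by_cases hxS : x ∈ S
        · have h4 : x ∉ M := fun h => ((memM x).1 h).2 hxS
          have h5 : x ∉ Y := fun h => h4 (hYM h)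
          have h6 := (hlfpos x).1 hxS
          by_cases hxB : x ∈ B
          · have h3 : x ∉ E := fun h => hEB x h hxB
            have h7 := ((memB x).1 hxB).2.2
            simp only [hxL, hxS, hxB, h3, h4, h5, if_true, if_false]
            by_cases h8 : (lf x).card = 1
            · have h9 : vtxPay (G.degree x) = 4 := by
                rw [← hd, h7, h8]; rfl
              omega
            · omega
          · simp only [hxL, hxS, hxB, h4, h5, if_true, if_false]
            by_cases hxE : x ∈ E
            · have h7 : 2 ≤ (g x).card := by
                by_contra hlt
                exact hxB ((memB x).2 ⟨hxS, ((memE x).1 hxE).1, by omega⟩)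
              have := hwle _ h7
              simp only [hxE, if_true]
              omega
            · simp only [hxE, if_false]
              omega
        · have hxM : x ∈ M := (memM x).2 ⟨hxL, hxS⟩
          have hxB : x ∉ B := fun h => hxS ((memB x).1 h).1
          have h6 : (lf x).card = 0 := by
            have := (hlfpos x).not.1 hxS
            omega
          have h7 : G.degree x ≠ 1 := fun h => hxL ((memL x).2 h)
          simp only [hxL, hxS, hxB, hxM, if_true, if_false]
          by_cases hxE : x ∈ E
          · have h8 : x ∉ Y := fun h => ((memE x).1 hxE).1 (hYU h)
            have h9 : vtxPay (G.degree x) = 2 + edgeWt (g x).card := by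
              rw [← hd, h6, Nat.zero_add] at h7 ⊢
              unfold vtxPay edgeWt
              split_ifs <;> omega
            simp only [hxE, h8, if_true, if_false]
            omega
          · simp only [hxE, if_false]
            split_ifs <;> omega
    have hsum := Finset.sum_le_sum (fun x (_ : x ∈ (Finset.univ : Finset V)) => hpt x)
    simp only [Finset.sum_add_distrib, ← Finset.mul_sum, Finset.sum_ite_mem, Finset.univ_inter,
      Finset.sum_const, smul_eq_mul, mul_one] at hsum
    have hlfsum : ∑ x, (lf x).card = L.card := by
      have e1 : ∀ x, (lf x).card = ∑ y, if G.Adj x y ∧ G.degree y = 1 then 1 else 0 := by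
        intro x
        rw [← Finset.card_filter]
        congr 1
        ext y
        simp [lf]
      have e2 : ∀ y, (∑ x, if G.Adj x y ∧ G.degree y = 1 then 1 else 0)
          = if G.degree y = 1 then 1 else 0 := by
        intro y
        rw [← Finset.card_filter]
        by_cases hy : G.degree y = 1
        · rw [if_pos hy]
          refine Eq.trans ?_ hy
          rw [← card_neighborFinset_eq_degree]
          congr 1
          ext x
          simp [hy, G.adj_comm]
        · simp [hy]
      rw [Finset.sum_congr rfl (fun x _ => e1 x), Finset.sum_comm,
        Finset.sum_congr rfl (fun y _ => e2 y), hL, Finset.card_filter]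
    have hc1 := Finset.card_union_le (S ∪ Y) T
    have hc2 := Finset.card_union_le S Y
    have hc3 := Finset.card_sdiff_add_card_eq_card hYM
    omega

theorem exists_light_set {V : Type*} [Fintype V] [DecidableEq V] (deg : V → ℕ) (m k : ℕ)
    (hm : ∑ x, deg x = 2 * m) (hpos : ∀ x, 1 ≤ deg x) (hkm : k ≤ m) (hkn : k ≤ Fintype.card V)
    (h1 : 2 * k ≤ m + (Finset.univ.filter (fun x => deg x = 1)).card)
    (h2 : 6 * k ≤ ∑ x, vtxPay (deg x)) :
    ∃ S : Finset V, S.card = k ∧ ∑ x ∈ S, deg x ≤ m := by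
  obtain ⟨S, hS, hmin⟩ := Finset.exists_min_image (Finset.powersetCard k (Finset.univ : Finset V))
    (fun S => ∑ x ∈ S, deg x) (Finset.powersetCard_nonempty.2 (by simpa using hkn))
  rw [Finset.mem_powersetCard] at hS
  have hSk := hS.2
  refine ⟨S, hSk, ?_⟩
  by_cases hne : S.Nonempty
  swap
  · rw [Finset.not_nonempty_iff_eq_empty] at hne
    simp [hne]
  obtain ⟨x0, hx0, hmax⟩ := Finset.exists_max_image S deg hne
  have hout : ∀ y, y ∉ S → deg x0 ≤ deg y := by
    intro y hy
    have hyn : y ∉ S.erase x0 := fun h => hy (Finset.mem_of_mem_erase h)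
    have h := hmin (insert y (S.erase x0)) (by
      rw [Finset.mem_powersetCard]
      refine ⟨Finset.subset_univ _, ?_⟩
      rw [Finset.card_insert_of_notMem hyn, Finset.card_erase_add_one hx0, hSk])
    simp only [Finset.sum_insert hyn] at h
    have h3 := Finset.sum_erase_add S deg hx0
    omega
  by_cases hd1 : deg x0 ≤ 1
  · have : ∑ x ∈ S, deg x ≤ S.card • 1 := Finset.sum_le_card_nsmul S deg 1 (fun x hx => (hmax x hx).trans hd1)
    rw [smul_eq_mul] at this
    omega
  by_cases hd2 : deg x0 = 2
  · have hl : (Finset.univ.filter (fun x => deg x = 1)).card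
        = ∑ x ∈ S, if deg x = 1 then 1 else 0 := by
      rw [← Finset.card_filter]
      congr 1
      ext x
      simp only [Finset.mem_filter, Finset.mem_univ, true_and]
      refine ⟨fun h => ⟨?_, h⟩, fun h => h.2⟩
      by_contra hx
      have := hout x hx
      omega
    have hle : ∑ x ∈ S, (deg x + if deg x = 1 then 1 else 0) ≤ ∑ x ∈ S, 2 := by
      refine Finset.sum_le_sum ?_
      intro x hx
      have := hmax x hx
      split_ifs <;> omega
    rw [Finset.sum_add_distrib, ← hl] at hle
    simp at hle
    omega
  · have hd3 : 3 ≤ deg x0 := by omega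
    have hA : ∑ x ∈ S, (3 * deg x + deg x0 * vtxPay (deg x)) ≤ ∑ x ∈ S, 6 * deg x0 := by
      refine Finset.sum_le_sum ?_
      intro x hx
      have := hmax x hx
      unfold vtxPay
      split_ifs <;> omega
    have hB : ∑ x ∈ Sᶜ, deg x0 * vtxPay (deg x) ≤ ∑ x ∈ Sᶜ, 3 * deg x := by
      refine Finset.sum_le_sum ?_
      intro x hx
      have := hout x (Finset.mem_compl.1 hx)
      unfold vtxPay
      split_ifs <;> omega
    have hs1 := Finset.sum_add_sum_compl S deg
    have hs2 := Finset.sum_add_sum_compl S (fun x => vtxPay (deg x))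
    rw [Finset.sum_add_distrib, ← Finset.mul_sum, ← Finset.mul_sum, Finset.sum_const, hSk,
      smul_eq_mul] at hA
    rw [← Finset.mul_sum, ← Finset.mul_sum] at hB
    have h3 := Nat.mul_le_mul_left (deg x0) h2
    rw [← hs2, Nat.mul_add] at h3
    have h4 : k * (6 * deg x0) = deg x0 * (6 * k) := by ring
    omega

theorem star_small {V : Type*} [Fintype V] [DecidableEq V] (G : SimpleGraph V)
    [DecidableRel G.Adj] (hG : G.Connected) (hn : 2 ≤ Fintype.card V) (x : V)
    (hx : ∀ y, G.Adj x y → G.degree y = 1) :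
    ∃ D : Finset V, (∀ v, ∃ u ∈ D, G.Adj v u) ∧ D.card ≤ 2 := by
  have hleaf : ∀ x y z, G.degree x = 1 → G.Adj x y → G.Adj x z → y = z := by
    intro x y z hx hy hz
    rw [← card_neighborFinset_eq_degree] at hx
    exact Finset.card_le_one.1 hx.le y (by simpa using hy) z (by simpa using hz)
  have key : ∀ u v, G.Walk u v → (u = x ∨ G.Adj x u) → (v = x ∨ G.Adj x v) := by
    intro u v p
    induction p with
    | nil => exact id
    | cons h q ih =>
      intro hu
      refine ih ?_
      rcases hu with rfl | hu
      · exact Or.inr h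
      · exact Or.inl (hleaf _ _ _ (hx _ hu) h hu.symm)
  have hall : ∀ v, v = x ∨ G.Adj x v := by
    intro v
    obtain ⟨p⟩ := hG.preconnected x v
    exact key x v p (Or.inl rfl)
  have : Nontrivial V := Fintype.one_lt_card_iff_nontrivial.1 hn
  obtain ⟨z, hz⟩ := exists_ne x
  have hxz : G.Adj x z := (hall z).resolve_left hz
  refine ⟨{x, z}, ?_, Finset.card_le_two⟩
  intro v
  rcases hall v with rfl | h
  · exact ⟨z, by simp, hxz⟩
  · exact ⟨x, by simp, h.symm⟩

theorem totalDom_le_annihilation {V : Type*} [Fintype V] (G : SimpleGraph V)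
    (hconn : G.Connected) : totalDominationNumber G ≤ annihilationNumber G + 1 := by
  classical
  have hle : ∀ D : Finset V, (∀ v : V, ∃ u ∈ D, G.Adj v u) → totalDominationNumber G ≤ D.card :=
    fun D hD => Nat.sInf_le ⟨D, hD, rfl⟩
  have hm : G.edgeSet.ncard = G.edgeFinset.card := by
    rw [← coe_edgeFinset, Set.ncard_coe_finset]
  have hdg : ∀ x, (G.neighborSet x).ncard = G.degree x := by
    intro x
    rw [← card_neighborFinset_eq_degree, ← Set.ncard_coe_finset, coe_neighborFinset]
  have hann : ∀ S : Finset V, ∑ x ∈ S, G.degree x ≤ G.edgeFinset.card →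
      S.card ≤ annihilationNumber G := by
    intro S hS
    refine le_csSup ⟨Fintype.card V, ?_⟩ ⟨S, rfl, ?_⟩
    · rintro k ⟨S, rfl, -⟩
      exact Finset.card_le_univ S
    · rw [hm]
      simpa only [hdg] using hS
  by_cases hn : 2 ≤ Fintype.card V
  swap
  · have hsub : Subsingleton V := Fintype.card_le_one_iff_subsingleton.1 (by omega)
    have : totalDominationNumber G = 0 := by
      refine Nat.sInf_eq_zero.2 (Or.inr ?_)
      rw [Set.eq_empty_iff_forall_notMem]
      rintro k ⟨D, hD, -⟩
      obtain ⟨v⟩ := hconn.nonempty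
      obtain ⟨u, -, hu⟩ := hD v
      exact hu.ne (Subsingleton.elim _ _)
    omega
  by_cases hst : ∀ x, ∃ y, G.Adj x y ∧ G.degree y ≠ 1
  · obtain ⟨D1, hD1, hc1⟩ := level_bound G hconn hn
    obtain ⟨D2, hD2, hc2⟩ := deg_bound G hst
    have ht1 := hle D1 hD1
    have ht2 := hle D2 hD2
    have ht3 := Finset.card_le_univ D1
    have hedge := hconn.card_vert_le_card_edgeSet_add_one
    rw [Nat.card_eq_fintype_card, Nat.card_coe_set_eq, hm] at hedge
    obtain ⟨S, hS, hSd⟩ := exists_light_set (fun x => G.degree x) G.edgeFinset.card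
      (totalDominationNumber G - 1) G.sum_degrees_eq_twice_card_edges (by
        intro x
        obtain ⟨y, hy, -⟩ := hst x
        exact (G.degree_pos_iff_exists_adj x).2 ⟨y, hy⟩) (by omega) (by omega) (by omega) (by omega)
    have := hann S hSd
    omega
  · push Not at hst
    obtain ⟨x, hx⟩ := hst
    obtain ⟨D, hD, hDc⟩ := star_small G hconn hn x hx
    have h1 := hle D hD
    have h2 := hann {x} (by
      rw [Finset.sum_singleton, ← card_incidenceFinset_eq_degree]
      exact Finset.card_le_card (G.incidenceFinset_subset x))
    rw [Finset.card_singleton] at h2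
    omega


/-- Let `G` be a connected graph with a cut-vertex `v ∈ V(G)` and
maximum degree `Δ(G) ≥ ⌊n(G)/4 + 4⌋`. If `G − v` has a connected component of order
`n(G) − Δ(G)`, then `γₜ(G) ≤ a(G) + 1`. -/
theorem stmt_12 {V : Type*} [Fintype V] (G : SimpleGraph V) (v : V)
    (hconn : G.Connected)
    (hcut : ¬ (G.induce {u | u ≠ v}).Connected)
    (hdeg : ⌊(Fintype.card V : ℚ) / 4 + 4⌋₊ ≤ maxDeg G)
    (hcomp : ∃ c : (G.induce {u | u ≠ v}).ConnectedComponent,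
      c.supp.ncard = Fintype.card V - maxDeg G) :
    totalDominationNumber G ≤ annihilationNumber G + 1 := by
  exact totalDom_le_annihilation G hconn
end
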